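/- arXiv:1304.0056 — 4 statements merged into one kernel-verified Lean document; each statement's English description precedes it below -/
import Mathlib

section
/- Let M be an automorphism-invariant module, R = End(M), and Δ = { r ∈ R : Ker(r) is essential in M }. Then Δ equals the Jacobson radical J(R) of R. -/
/-- A submodule is essential if it intersects every nonzero submodule nontrivially. -/
def IsEssential {R M : Type*} [Ring R] [AddCommGroup M] [Module R M]
    (N : Submodule R M) : Prop :=
  ∀ K : Submodule R M, K ≠ ⊥ → N ⊓ K ≠ ⊥

theorem IsEssential.mono {R M : Type*} [Ring R] [AddCommGroup M] [Module R M]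
    {N P : Submodule R M} (hN : IsEssential N) (h : N ≤ P) : IsEssential P :=
  fun K hK hP => hN K hK (le_bot_iff.1 ((inf_le_inf_right K h).trans hP.le))

/-- Every submodule has a complement up to essentiality. -/
theorem Submodule.exists_maximal_disjoint {R E : Type*} [Ring R] [AddCommGroup E] [Module R E]
    (P : Submodule R E) : ∃ C, Maximal (fun N : Submodule R E => Disjoint P N) C := by
  obtain ⟨C, -, hC⟩ := zorn_le_nonempty₀ {N : Submodule R E | Disjoint P N}
    (fun c hc hchain y _ => ⟨sSup c,
      hchain.directedOn.disjoint_sSup_right.2 fun N hN => hc hN, fun N hN => le_sSup hN⟩)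
    ⊥ disjoint_bot_right
  exact ⟨C, hC⟩

/-- The sum of a submodule and a maximal submodule disjoint from it is essential. -/
theorem Maximal.isEssential_sup {R E : Type*} [Ring R] [AddCommGroup E] [Module R E]
    {P C : Submodule R E} (hC : Maximal (fun N : Submodule R E => Disjoint P N) C) :
    IsEssential (P ⊔ C) := by
  intro N hN h
  have hle : N ≤ C := le_sup_right.trans (hC.2
    (hC.1.disjoint_sup_right_of_disjoint_sup_left (disjoint_iff.2 h)) le_sup_left)
  exact hN (by rwa [inf_eq_right.2 (hle.trans le_sup_right)] at h)

theorem IsEssential.map_subtype {R E : Type*} [Ring R] [AddCommGroup E] [Module R E]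
    {M : Submodule R E} (hM : IsEssential M) {N : Submodule R M} (hN : IsEssential N) :
    IsEssential (N.map M.subtype) := by
  intro K hK h
  obtain ⟨x, ⟨hxM, hxK⟩, hx⟩ := Submodule.exists_mem_ne_zero_of_ne_bot (hM K hK)
  have hne : K.comap M.subtype ≠ ⊥ := by
    intro hb
    have : (⟨x, hxM⟩ : M) ∈ K.comap M.subtype := hxK
    rw [hb, Submodule.mem_bot] at this
    exact hx (congrArg Subtype.val this)
  obtain ⟨y, ⟨hyN, hyK⟩, hy⟩ := Submodule.exists_mem_ne_zero_of_ne_bot (hN _ hne)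
  have : (y : E) ∈ N.map M.subtype ⊓ K := ⟨⟨y, hyN, rfl⟩, hyK⟩
  rw [h, Submodule.mem_bot] at this
  exact hy (Subtype.ext this)

/-- A linear map that is injective on an essential submodule is injective. -/
theorem IsEssential.injective_of_comp {R E F X : Type*} [Ring R] [AddCommGroup E] [Module R E]
    [AddCommGroup F] [Module R F] [AddCommGroup X] [Module R X] {i : X →ₗ[R] E}
    (hi : IsEssential (LinearMap.range i)) {f : E →ₗ[R] F}
    (h : Function.Injective (f ∘ₗ i)) : Function.Injective f := by
  rw [← LinearMap.ker_eq_bot]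
  by_contra hne
  refine hi _ hne ((Submodule.eq_bot_iff _).2 ?_)
  rintro _ ⟨⟨x, rfl⟩, hx⟩
  have : x = 0 := h (by simpa using hx)
  simp [this]

/-- Two essential embeddings into an injective module differ by an automorphism. -/
theorem Module.Injective.exists_linearEquiv_of_isEssential_range.{u, v} {R : Type u} {E X : Type v}
    [Ring R] [AddCommGroup E] [Module R E] (hE : Module.Injective R E) [AddCommGroup X] [Module R X]
    {i j : X →ₗ[R] E} (hi : Function.Injective i) (hj : Function.Injective j)
    (hie : IsEssential (LinearMap.range i)) (hje : IsEssential (LinearMap.range j)) :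
    ∃ φ : E ≃ₗ[R] E, ∀ x, φ (i x) = j x := by
  obtain ⟨f, hf⟩ := hE.out i hi j
  have hfinj : Function.Injective f := hie.injective_of_comp (by
    rwa [show f ∘ₗ i = j from LinearMap.ext hf])
  obtain ⟨g, hg⟩ := hE.out f hfinj LinearMap.id
  have hginj : Function.Injective g := hje.injective_of_comp (by
    rwa [show g ∘ₗ j = i from LinearMap.ext fun x => by simp [← hf, hg]])
  exact ⟨LinearEquiv.ofBijective f ⟨hfinj, fun x => ⟨g x, hginj (hg (g x))⟩⟩, hf⟩

/-- Two embeddings into an injective module whose ranges are disjoint from the same submodules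
differ by an automorphism. -/
theorem Module.Injective.exists_linearEquiv_of_disjoint_range_iff.{u, v} {R : Type u} {E X : Type v}
    [Ring R] [AddCommGroup E] [Module R E] (hE : Module.Injective R E)
    [AddCommGroup X] [Module R X] {i j : X →ₗ[R] E}
    (hi : Function.Injective i) (hj : Function.Injective j)
    (h : ∀ N, Disjoint (LinearMap.range i) N ↔ Disjoint (LinearMap.range j) N) :
    ∃ φ : E ≃ₗ[R] E, ∀ x, φ (i x) = j x := by
  obtain ⟨C, hC⟩ := (LinearMap.range i).exists_maximal_disjoint
  have hC' : Maximal (fun N => Disjoint (LinearMap.range j) N) C := by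
    simpa only [h] using hC
  have hinj : ∀ k : X →ₗ[R] E, Function.Injective k → Disjoint (LinearMap.range k) C →
      Function.Injective (k.coprod C.subtype) := fun k hk hd => by
    rw [← LinearMap.ker_eq_bot, LinearMap.ker_coprod_of_disjoint_range _ _ (by simpa using hd),
      LinearMap.ker_eq_bot.2 hk, Submodule.ker_subtype, Submodule.prod_bot]
  obtain ⟨φ, hφ⟩ := hE.exists_linearEquiv_of_isEssential_range
    (hinj i hi hC.1) (hinj j hj hC'.1)
    (by simpa [LinearMap.range_coprod] using hC.isEssential_sup)
    (by simpa [LinearMap.range_coprod] using hC'.isEssential_sup)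
  exact ⟨φ, fun x => by simpa using hφ (x, 0)⟩

/-- Any two embeddings of a nonzero module into an injective module agree, up to an automorphism,
at some nonzero element. -/
theorem Module.Injective.exists_linearEquiv_apply_eq.{u, v} {R : Type u} {E X : Type v}
    [Ring R] [AddCommGroup E] [Module R E] (hE : Module.Injective R E)
    [AddCommGroup X] [Module R X] [Nontrivial X] {i j : X →ₗ[R] E}
    (hi : Function.Injective i) (hj : Function.Injective j) :
    ∃ (φ : E ≃ₗ[R] E) (x : X), x ≠ 0 ∧ φ (i x) = j x := by
  by_cases hX : ∃ Y : Submodule R X, Y ≠ ⊥ ∧ Disjoint (Y.map i) (Y.map j)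
  · obtain ⟨Y, hY, hd⟩ := hX
    obtain ⟨y, hyY, hy⟩ := Submodule.exists_mem_ne_zero_of_ne_bot hY
    have hinj : ∀ k l : X →ₗ[R] E, Function.Injective k → Function.Injective l →
        Disjoint (Y.map k) (Y.map l) →
        Function.Injective ((k.domRestrict Y).coprod (l.domRestrict Y)) := fun k l hk hl hd => by
      rw [← LinearMap.ker_eq_bot, LinearMap.ker_coprod_of_disjoint_range _ _
          (by simpa [LinearMap.range_domRestrict] using hd),
        LinearMap.ker_eq_bot (f := k.domRestrict Y) |>.2 (hk.comp Subtype.val_injective),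
        LinearMap.ker_eq_bot (f := l.domRestrict Y) |>.2 (hl.comp Subtype.val_injective),
        Submodule.prod_bot]
    obtain ⟨φ, hφ⟩ := hE.exists_linearEquiv_of_disjoint_range_iff
      (hinj i j hi hj hd) (hinj j i hj hi hd.symm)
      (fun N => by rw [LinearMap.range_coprod, LinearMap.range_coprod, sup_comm])
    exact ⟨φ, y, hy, by simpa using hφ (⟨y, hyY⟩, 0)⟩
  · push Not at hX
    have key : ∀ Y : Submodule R X, Y ≠ ⊥ → ∃ a ∈ Y, ∃ b ∈ Y, b ≠ 0 ∧ i a = j b := by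
      intro Y hY
      obtain ⟨_, ⟨⟨a, ha, rfl⟩, b, hb, hab⟩, hne⟩ :=
        Submodule.exists_mem_ne_zero_of_ne_bot fun h => hX Y hY (disjoint_iff.2 h)
      exact ⟨a, ha, b, hb, by rintro rfl; simp [← hab] at hne, hab.symm⟩
    let Y : Submodule R X := (LinearMap.range i).comap j
    have hmem : ∀ N : Submodule R E, ¬ Disjoint (LinearMap.range i) N →
        ¬ Disjoint (Y.map i) N ∧ ¬ Disjoint (Y.map j) N := by
      intro N hN
      have hne : N.comap i ≠ ⊥ := fun h => hN <| by
        rw [Submodule.disjoint_def]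
        rintro _ ⟨x, rfl⟩ hx
        have : x ∈ N.comap i := hx
        rw [h, Submodule.mem_bot] at this
        simp [this]
      obtain ⟨a, ha, b, hb, hb0, hab⟩ := key _ hne
      have hbY : b ∈ Y := ⟨a, hab⟩
      constructor <;> intro hd
      · exact hb0 ((map_eq_zero_iff i hi).1
          (Submodule.disjoint_def.1 hd _ ⟨b, hbY, rfl⟩ hb))
      · exact hb0 ((map_eq_zero_iff j hj).1
          (Submodule.disjoint_def.1 hd _ ⟨b, hbY, rfl⟩ (hab ▸ ha)))
    have hYi : Y.map i ≤ LinearMap.range i := LinearMap.map_le_range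
    have hYj : Y.map j ≤ LinearMap.range i := Submodule.map_comap_le _ _
    obtain ⟨φ, hφ⟩ := hE.exists_linearEquiv_of_disjoint_range_iff
      (i := i.domRestrict Y) (j := j.domRestrict Y)
      (hi.comp Subtype.val_injective) (hj.comp Subtype.val_injective) (fun N => by
        rw [LinearMap.range_domRestrict, LinearMap.range_domRestrict]
        exact ⟨fun h => (not_imp_not.1 fun hn => (hmem N hn).1) h |>.mono_left hYj,
          fun h => (not_imp_not.1 fun hn => (hmem N hn).2) h |>.mono_left hYi⟩)
    obtain ⟨a, -, b, -, hb, hab⟩ := key ⊤ top_ne_bot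
    exact ⟨φ, b, hb, hφ ⟨b, a, hab⟩⟩

/-- For an automorphism-invariant module M (with injective hull E), the set
Δ of endomorphisms of M with essential kernel equals the Jacobson radical of End(M). -/
theorem stmt2 {R E : Type*} [Ring R] [AddCommGroup E] [Module R E]
    (hE : Module.Injective R E) (M : Submodule R E)
    (hess : IsEssential M)
    (hinv : ∀ φ : E ≃ₗ[R] E, ∀ x ∈ M, φ x ∈ M)
    (r : Module.End R ↥M) :
    r ∈ Ideal.jacobson (⊥ : Ideal (Module.End R ↥M)) ↔
      IsEssential (LinearMap.ker r) := by
  simp only [Ideal.mem_jacobson_iff, Ideal.mem_bot, sub_eq_zero]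
  constructor
  · intro hr K hK hd
    have : Nontrivial K := Submodule.nontrivial_iff_ne_bot.2 hK
    have hrK : Function.Injective (r ∘ₗ K.subtype) := by
      rw [← LinearMap.ker_eq_bot, LinearMap.ker_comp, ← Submodule.disjoint_iff_comap_eq_bot,
        disjoint_iff, inf_comm, hd]
    obtain ⟨φ, x, hx, hφ⟩ := hE.exists_linearEquiv_apply_eq
      (i := M.subtype ∘ₗ K.subtype) (j := M.subtype ∘ₗ r ∘ₗ K.subtype)
      (Subtype.val_injective.comp Subtype.val_injective) (Subtype.val_injective.comp hrK)
    let s : Module.End R M := φ.symm.toLinearMap.restrict (hinv φ.symm)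
    have hs : s (r x) = x := Subtype.ext (φ.symm_apply_eq.2 hφ.symm)
    obtain ⟨z, hz⟩ := hr (-s)
    have hzx := LinearMap.congr_fun hz (x : M)
    exact hx (Subtype.ext (by simpa [hs] using hzx.symm))
  · intro hr y
    have hfix : ∀ x ∈ LinearMap.ker r, (y * r + 1) x = x := fun x hx => by
      simp [LinearMap.mem_ker.1 hx]
    have hinj : Function.Injective ⇑(y * r + 1) :=
      IsEssential.injective_of_comp (i := (LinearMap.ker r).subtype) (by simpa using hr)
        fun a b hab => Subtype.ext <| by
          simpa only [LinearMap.comp_apply, Submodule.subtype_apply, hfix _ a.2, hfix _ b.2]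
            using hab
    obtain ⟨φ, hφ⟩ := hE.exists_linearEquiv_of_isEssential_range
      (i := M.subtype) (j := M.subtype ∘ₗ (y * r + 1))
      Subtype.val_injective (Subtype.val_injective.comp hinj) (by simpa using hess)
      ((hess.map_subtype hr).mono (by
        rintro _ ⟨x, hx, rfl⟩
        exact ⟨x, congrArg Subtype.val (hfix x hx)⟩))
    refine ⟨φ.symm.toLinearMap.restrict (hinv φ.symm), ?_⟩
    ext x
    have hx := φ.symm_apply_eq.2 (hφ x).symm
    simpa using hx
end

section
/- Let M be an automorphism-invariant module with endomorphism ring R. Then R/J(R) is a von Neumann regular ring, where J(R) is the Jacobson radical. -/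
namespace Submodule

variable {R E : Type*} [Ring R] [AddCommGroup E] [Module R E]

/-- `Y` meets every nonzero submodule of `X` nontrivially (without requiring `Y ≤ X`). -/
def EssentialIn (Y X : Submodule R E) : Prop :=
  ∀ Z ≤ X, Disjoint Y Z → Z = ⊥

theorem EssentialIn.mono {Y Y' X : Submodule R E} (h : EssentialIn Y X) (hY : Y ≤ Y') :
    EssentialIn Y' X :=
  fun Z hZ hd => h Z hZ (hd.mono_left hY)

theorem exists_relative_complement {X C B : Submodule R E} (hC : C ≤ B) (hd : Disjoint X C) :
    ∃ C', C ≤ C' ∧ C' ≤ B ∧ Disjoint X C' ∧ EssentialIn (X ⊔ C') B := by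
  obtain ⟨C', hCC', hmax⟩ := zorn_le_nonempty₀ {D : Submodule R E | D ≤ B ∧ Disjoint X D} (by
    intro c hc hchain y hy
    refine ⟨sSup c, ⟨sSup_le fun D hD => (hc hD).1, ?_⟩, fun D hD => le_sSup hD⟩
    exact hchain.directedOn.disjoint_sSup_right.mpr fun D hD => (hc hD).2) C ⟨hC, hd⟩
  refine ⟨C', hCC', hmax.prop.1, hmax.prop.2, fun Z hZ hZd => ?_⟩
  have h1 : Disjoint X (C' ⊔ Z) := hmax.prop.2.disjoint_sup_right_of_disjoint_sup_left hZd
  have h2 : C' ⊔ Z ≤ C' := hmax.le_of_ge ⟨sup_le hmax.prop.1 hZ, h1⟩ le_sup_left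
  exact disjoint_self.mp (hZd.mono_left ((le_sup_right.trans h2).trans le_sup_right))

theorem EssentialIn.sup_of_essentialIn {X Y C B : Submodule R E} (hXC : EssentialIn (X ⊔ C) B)
    (hYX : EssentialIn Y X) (hle : Y ≤ X) (hd : Disjoint X C) : EssentialIn (Y ⊔ C) B := by
  intro Z hZ hZd
  have h1 : Disjoint Y (C ⊔ Z) :=
    (hd.mono_left hle).disjoint_sup_right_of_disjoint_sup_left hZd
  have h2 : Disjoint X (C ⊔ Z) :=
    disjoint_iff.mpr (hYX _ inf_le_left (h1.mono_right inf_le_right))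
  exact hXC Z hZ (Disjoint.disjoint_sup_left_of_disjoint_sup_right
    (hZd.mono_left le_sup_right) h2)

end Submodule

namespace Module.Injective

open Submodule

variable {R E : Type*} [Ring R] [AddCommGroup E] [Module R E]

theorem exists_eq_and_eq_zero (hE : Module.Injective R E) {X C : Submodule R E}
    (hd : Disjoint X C) (g : X →ₗ[R] E) :
    ∃ ψ : Module.End R E, (∀ x : X, ψ x = g x) ∧ ∀ c ∈ C, ψ c = 0 := by
  obtain ⟨ψ, hψ⟩ := hE.out (X.subtype.coprod C.subtype)
    (by
      rw [← LinearMap.ker_eq_bot, LinearMap.ker_coprod_of_disjoint_range]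
      · simp
      · simpa using hd) (g.coprod 0)
  refine ⟨ψ, fun x => ?_, fun c hc => ?_⟩
  · simpa using hψ (x, 0)
  · simpa using hψ (0, ⟨c, hc⟩)

theorem exists_eqOn_and_eq_zero (hE : Module.Injective R E) {X C : Submodule R E}
    (hd : Disjoint X C) (g : Module.End R E) :
    ∃ ψ : Module.End R E, (∀ x ∈ X, ψ x = g x) ∧ ∀ c ∈ C, ψ c = 0 := by
  obtain ⟨ψ, h1, h2⟩ := hE.exists_eq_and_eq_zero hd (g.domRestrict X)
  exact ⟨ψ, fun x hx => h1 ⟨x, hx⟩, h2⟩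

theorem exists_leftInverse_on (hE : Module.Injective R E) {X C : Submodule R E}
    {f : Module.End R E} (hf : Disjoint X (LinearMap.ker f)) (hd : Disjoint (X.map f) C) :
    ∃ φ : Module.End R E, (∀ x ∈ X, φ (f x) = x) ∧ ∀ c ∈ C, φ c = 0 := by
  have hinj : Function.Injective (f.domRestrict X) := by
    rw [injective_iff_map_eq_zero]
    intro x hx
    exact Subtype.ext (disjoint_def.mp hf x x.2 (by simpa using hx))
  obtain ⟨φ, hφ⟩ := hE.out ((f.domRestrict X).coprod C.subtype)
    (by
      rw [← LinearMap.ker_eq_bot, LinearMap.ker_coprod_of_disjoint_range]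
      · simp [LinearMap.ker_eq_bot.mpr hinj]
      · simpa [LinearMap.range_domRestrict] using hd) (X.subtype.coprod 0)
  refine ⟨φ, fun x hx => ?_, fun c hc => ?_⟩
  · simpa using hφ (⟨x, hx⟩, 0)
  · simpa using hφ (0, ⟨c, hc⟩)

theorem bijective_of_essentialIn (hE : Module.Injective R E) {N : Submodule R E}
    {θ : Module.End R E} (hN : EssentialIn N ⊤) (hinj : Disjoint N (LinearMap.ker θ))
    (him : EssentialIn (N.map θ) ⊤) : Function.Bijective θ := by
  have hker : Function.Injective θ := LinearMap.ker_eq_bot.mp (hN _ le_top hinj)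
  obtain ⟨ρ, hρ⟩ := hE.out θ hker LinearMap.id
  have hρker : LinearMap.ker ρ = ⊥ := by
    refine him _ le_top (disjoint_def.mpr ?_)
    rintro _ ⟨x, -, rfl⟩ hx
    have : x = 0 := by simpa [hρ] using hx
    simp [this]
  refine ⟨hker, fun y => ⟨ρ y, LinearMap.ker_eq_bot.mp hρker ?_⟩⟩
  simpa using hρ (ρ y)

theorem bijective_one_add (hE : Module.Injective R E) {ψ : Module.End R E}
    (hψ : EssentialIn (LinearMap.ker ψ) ⊤) : Function.Bijective (1 + ψ : Module.End R E) := by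
  have hfix : ∀ x ∈ LinearMap.ker ψ, (1 + ψ) x = x := fun x hx => by
    simp [LinearMap.mem_ker.mp hx]
  refine hE.bijective_of_essentialIn hψ (disjoint_def.mpr fun x hx hx' => ?_)
    (hψ.mono fun x hx => ⟨x, hx, hfix x hx⟩)
  rw [← hfix x hx]
  exact hx'

theorem bijective_one_add_of_sq (hE : Module.Injective R E) {ψ : Module.End R E}
    (hψ : EssentialIn (LinearMap.ker (ψ * ψ)) ⊤) : Function.Bijective (1 + ψ : Module.End R E) := by
  have hb : Function.Bijective (1 + -(ψ * ψ) : Module.End R E) := by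
    refine hE.bijective_one_add (hψ.mono fun x hx => ?_)
    simpa using hx
  have h1 : (1 - ψ) * (1 + ψ) = 1 + -(ψ * ψ) := by noncomm_ring
  have h2 : (1 + ψ) * (1 - ψ) = 1 + -(ψ * ψ) := by noncomm_ring
  refine ⟨Function.Injective.of_comp (f := (1 - ψ : Module.End R E)) ?_,
    Function.Surjective.of_comp (g := (1 - ψ : Module.End R E)) ?_⟩
  · rw [← Module.End.coe_mul, h1]; exact hb.1
  · rw [← Module.End.coe_mul, h2]; exact hb.2

section UnitStable

variable {G : Subring (Module.End R E)}
  (hG : ∀ u : Module.End R E, Function.Bijective u → u ∈ G)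

include hG

theorem mem_of_ker_sq_essentialIn (hE : Module.Injective R E) {ψ : Module.End R E}
    (hψ : EssentialIn (LinearMap.ker (ψ * ψ)) ⊤) : ψ ∈ G := by
  simpa using sub_mem (hG _ (hE.bijective_one_add_of_sq hψ)) (one_mem G)

theorem mem_of_ker_essentialIn (hE : Module.Injective R E) {ψ : Module.End R E}
    (hψ : EssentialIn (LinearMap.ker ψ) ⊤) : ψ ∈ G := by
  simpa using sub_mem (hG _ (hE.bijective_one_add hψ)) (one_mem G)

theorem exists_mem_eqOn_of_map_le (hE : Module.Injective R E) {X C : Submodule R E}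
    (hd : Disjoint X C) {g : Module.End R E} (hg : X.map g ≤ C) :
    ∃ ψ ∈ G, (∀ x ∈ X, ψ x = g x) ∧ ∀ c ∈ C, ψ c = 0 := by
  obtain ⟨C', hCC', -, hd', hess⟩ := exists_relative_complement le_top hd
  obtain ⟨ψ, h1, h2⟩ := hE.exists_eqOn_and_eq_zero hd' g
  refine ⟨ψ, mem_of_ker_sq_essentialIn hG hE (hess.mono (sup_le ?_ ?_)), h1,
    fun c hc => h2 c (hCC' hc)⟩
  · intro x hx
    simp [h1 x hx, h2 _ (hCC' (hg (mem_map_of_mem hx)))]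
  · intro x hx
    simp [h2 x hx]

theorem exists_mem_eqOn_of_essentialIn (hE : Module.Injective R E) {X Y C : Submodule R E}
    (hd : Disjoint X C) (hle : Y ≤ X) (hess : EssentialIn Y X) {g ψ : Module.End R E}
    (hψ : ψ ∈ G) (hY : ∀ y ∈ Y, ψ y = g y) (hC : ∀ c ∈ C, ψ c = 0) :
    ∃ ψ ∈ G, (∀ x ∈ X, ψ x = g x) ∧ ∀ c ∈ C, ψ c = 0 := by
  obtain ⟨C', hCC', -, hd', hess'⟩ := exists_relative_complement le_top hd
  obtain ⟨δ, h1, h2⟩ := hE.exists_eqOn_and_eq_zero hd' (g - ψ)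
  have hδ : δ ∈ G := by
    refine mem_of_ker_essentialIn hG hE
      ((hess'.sup_of_essentialIn hess hle hd').mono (sup_le ?_ fun x hx => h2 x hx))
    intro y hy
    simp [h1 y (hle hy), hY y hy]
  refine ⟨ψ + δ, add_mem hψ hδ, fun x hx => ?_, fun c hc => ?_⟩
  · simp [h1 x hx]
  · simp [hC c hc, h2 c (hCC' hc)]

/-- A submodule with a disjoint isomorphic copy has its projections in every subring
containing the automorphisms. -/
theorem exists_mem_projection (hE : Module.Injective R E) {X C : Submodule R E}
    {h : Module.End R E} (hinj : Disjoint X (LinearMap.ker h)) (hcopy : Disjoint X (X.map h))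
    (hd : Disjoint X C) :
    ∃ e ∈ G, (∀ x ∈ X, e x = x) ∧ ∀ c ∈ C, e c = 0 := by
  obtain ⟨C', hCC', -, hd', hess⟩ := exists_relative_complement le_top hd
  obtain ⟨p, hpC, hpX⟩ := hE.exists_eqOn_and_eq_zero hd'.symm 1
  set X₀ := X ⊓ (X ⊔ C').comap h
  have hX₀ess : EssentialIn X₀ X := by
    intro Z hZ hZd
    have hmap : Z.map h = ⊥ := by
      refine hess _ le_top (disjoint_def.mpr ?_)
      rintro _ hx ⟨z, hz, rfl⟩
      rw [disjoint_def.mp hZd z ⟨hZ hz, hx⟩ hz, map_zero]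
    refine eq_bot_iff.mpr fun z hz => (disjoint_def.mp hinj z (hZ hz) ?_ : z = 0)
    have : h z ∈ Z.map h := mem_map_of_mem hz
    rw [hmap] at this
    exact this
  have hph : ∀ x ∈ X₀, p (h x) ∈ C' ∧ (p (h x) = 0 → x = 0) := by
    rintro x ⟨hx, hx'⟩
    obtain ⟨y, hy, c, hc, hyc⟩ := mem_sup.mp hx'
    have hp : p (h x) = c := by simp [← hyc, hpX y hy, hpC c hc]
    refine ⟨hp ▸ hc, fun h0 => ?_⟩
    rw [hp] at h0
    have hhx : h x = 0 := disjoint_def.mp hcopy _ (by simpa [← hyc, h0] using hy)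
      (mem_map_of_mem hx)
    exact disjoint_def.mp hinj x hx hhx
  have hmap : X₀.map (p * h) ≤ C' := by
    rintro _ ⟨x, hx, rfl⟩
    exact (hph x hx).1
  have hX₀C : Disjoint X₀ C' := hd'.mono_left inf_le_left
  obtain ⟨s, hsG, hs, hsC⟩ := exists_mem_eqOn_of_map_le hG hE hX₀C hmap
  obtain ⟨q, hq, -⟩ := hE.exists_leftInverse_on (X := X₀) (f := p * h) (C := ⊥)
    (disjoint_def.mpr fun x hx hx0 => (hph x hx).2 hx0) disjoint_bot_right
  obtain ⟨t, htG, ht, -⟩ := exists_mem_eqOn_of_map_le hG hE (X := X₀.map (p * h)) (C := X₀)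
    (g := q) (hX₀C.symm.mono_left hmap) (by
      rintro _ ⟨_, ⟨x, hx, rfl⟩, rfl⟩
      rw [hq x hx]
      exact hx)
  exact exists_mem_eqOn_of_essentialIn hG hE hd inf_le_left hX₀ess (g := 1) (mul_mem htG hsG)
    (fun x hx => by
      rw [Module.End.mul_apply, hs x hx, ht _ (mem_map_of_mem hx), hq x hx]; rfl)
    (fun c hc => by rw [Module.End.mul_apply, hsC c (hCC' hc), map_zero])

theorem exists_mem_eqOn_of_copy (hE : Module.Injective R E) {X C : Submodule R E}
    {h : Module.End R E} (hinj : Disjoint X (LinearMap.ker h)) (hcopy : Disjoint X (X.map h))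
    (hd : Disjoint X C) (g : Module.End R E) :
    ∃ ψ ∈ G, (∀ x ∈ X, ψ x = g x) ∧ ∀ c ∈ C, ψ c = 0 := by
  obtain ⟨e, heG, heX, heC⟩ := exists_mem_projection hG hE hinj hcopy hd
  suffices ∃ ψ ∈ G, (∀ x ∈ X, ψ x = g x) ∧ ∀ c ∈ (⊥ : Submodule R E), ψ c = 0 by
    obtain ⟨ψ, hψG, hψ, -⟩ := this
    exact ⟨ψ * e, mul_mem hψG heG, fun x hx => by simp [heX x hx, hψ x hx],
      fun c hc => by simp [heC c hc]⟩
  set U := X ⊓ X.comap g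
  have hUX : U ≤ X := inf_le_left
  obtain ⟨V, -, hVX, hUV, hess⟩ :=
    exists_relative_complement (X := U) (bot_le : ⊥ ≤ X) disjoint_bot_right
  obtain ⟨s, hsG, hs, -⟩ := exists_mem_eqOn_of_map_le hG hE (X := U) (C := X.map h) (g := h * g)
    (hcopy.mono_left hUX) (by
      rintro _ ⟨x, hx, rfl⟩
      exact mem_map_of_mem hx.2)
  obtain ⟨q, hq, -⟩ := hE.exists_leftInverse_on (C := ⊥) hinj disjoint_bot_right
  obtain ⟨t, htG, ht, -⟩ := exists_mem_eqOn_of_map_le hG hE (g := q) hcopy.symm (by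
    rintro _ ⟨_, ⟨x, hx, rfl⟩, rfl⟩
    rwa [hq x hx])
  obtain ⟨v, hvG, hv, -⟩ := exists_mem_eqOn_of_map_le hG hE (X := V) (C := V.map g) (g := g)
    (disjoint_def.mpr (by
      rintro _ hx ⟨y, hy, rfl⟩
      rw [disjoint_def.mp hUV y ⟨hVX hy, hVX hx⟩ hy, map_zero])) le_rfl
  obtain ⟨d, hdG, hdU, hdV⟩ := exists_mem_projection hG hE (hinj.mono_left hUX)
    (hcopy.mono hUX (map_mono hUX)) hUV
  refine exists_mem_eqOn_of_essentialIn hG hE disjoint_bot_right (sup_le hUX hVX) hess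
    (ψ := t * s * d + v * (1 - d))
    (add_mem (mul_mem (mul_mem htG hsG) hdG) (mul_mem hvG (sub_mem (one_mem G) hdG))) ?_
    (by simp)
  intro y hy
  obtain ⟨a, ha, b, hb, rfl⟩ := mem_sup.mp hy
  have hta : t (h (g a)) = g a := by rw [ht _ (mem_map_of_mem ha.2), hq _ ha.2]
  simp [hdU a ha, hdV b hb, hs a ha, hta, hv b hb]

theorem exists_mem_eqOn_of_sup_copy (hE : Module.Injective R E) {X N A : Submodule R E}
    {h f : Module.End R E} (hinj : Disjoint X (LinearMap.ker h)) (hcopy : Disjoint X (X.map h))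
    (hd : Disjoint X N) (hXA : X ≤ A) (hNA : N ≤ A) (hess : EssentialIn (X ⊔ N) A)
    (hN : ∃ ψ ∈ G, ∀ x ∈ N, ψ x = f x) : ∃ ψ ∈ G, ∀ x ∈ A, ψ x = f x := by
  obtain ⟨ψ, hψG, hψ⟩ := hN
  obtain ⟨φ, hφG, hφX, hφN⟩ := exists_mem_eqOn_of_copy hG hE hinj hcopy hd (f - ψ)
  obtain ⟨χ, hχG, hχ, -⟩ := exists_mem_eqOn_of_essentialIn hG hE (C := ⊥) disjoint_bot_right
    (sup_le hXA hNA) hess (g := f) (add_mem hψG hφG) (by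
      intro y hy
      obtain ⟨a, ha, b, hb, rfl⟩ := mem_sup.mp hy
      simp only [LinearMap.add_apply, map_add, hφX a ha, hφN b hb, hψ b hb, LinearMap.sub_apply]
      abel) (by simp)
  exact ⟨χ, hχG, hχ⟩

theorem exists_mem_eqOn_of_not_disjoint_map (hE : Module.Injective R E) {D : Submodule R E}
    {g : Module.End R E} (hinj : Disjoint D (LinearMap.ker g))
    (hD : ∀ X ≤ D, Disjoint X (X.map g) → X = ⊥) : ∃ ψ ∈ G, ∀ x ∈ D, ψ x = g x := by
  set B := D ⊓ D.map g
  obtain ⟨C, -, -, hBC, hess⟩ :=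
    exists_relative_complement (X := B) (le_top : ⊥ ≤ ⊤) disjoint_bot_right
  have hDC : Disjoint D C := by
    refine disjoint_iff.mpr (hD _ inf_le_left (disjoint_def.mpr ?_))
    rintro _ hx ⟨y, hy, rfl⟩
    exact disjoint_def.mp hBC _ ⟨hx.1, mem_map_of_mem hy.1⟩ hx.2
  have hgDC : Disjoint (D.map g) C := by
    have h0 : D ⊓ C.comap g = ⊥ := by
      refine hD _ inf_le_left (disjoint_def.mpr ?_)
      rintro _ hx ⟨y, hy, rfl⟩
      exact disjoint_def.mp hBC _ ⟨hx.1, mem_map_of_mem hy.1⟩ hy.2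
    refine disjoint_def.mpr ?_
    rintro _ ⟨x, hx, rfl⟩ hxC
    have : x ∈ D ⊓ C.comap g := ⟨hx, hxC⟩
    rw [h0] at this
    rw [(mem_bot R).mp this, map_zero]
  obtain ⟨φ, hφD, hφC⟩ := hE.exists_eqOn_and_eq_zero hDC (g - 1)
  have h1 : ∀ x ∈ D, (1 + φ) x = g x := fun x hx => by simp [hφD x hx]
  have h2 : ∀ x ∈ C, (1 + φ) x = x := fun x hx => by simp [hφC x hx]
  refine ⟨1 + φ, hG _ (hE.bijective_of_essentialIn (N := D ⊔ C)
    (hess.mono (sup_le_sup_right inf_le_left C)) (disjoint_def.mpr ?_) (hess.mono ?_)), h1⟩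
  · intro x hx hx0
    obtain ⟨a, ha, c, hc, rfl⟩ := mem_sup.mp hx
    rw [LinearMap.mem_ker, map_add, h1 a ha, h2 c hc] at hx0
    have hga : g a = 0 := disjoint_def.mp hgDC _ (mem_map_of_mem ha)
      (by rw [eq_neg_of_add_eq_zero_left hx0]; exact neg_mem hc)
    rw [hga, zero_add] at hx0
    rw [hx0, disjoint_def.mp hinj a ha hga, add_zero]
  · refine sup_le ?_ fun x hx => ⟨x, mem_sup_right hx, h2 x hx⟩
    rintro _ ⟨-, x, hx, rfl⟩
    exact ⟨x, mem_sup_left hx, h1 x hx⟩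

theorem exists_mem_eqOn_of_disjoint_ker (hE : Module.Injective R E) {A : Submodule R E}
    {f : Module.End R E} (hf : Disjoint A (LinearMap.ker f)) :
    ∃ ψ ∈ G, ∀ x ∈ A, ψ x = f x := by
  obtain ⟨A₀, -, hmax⟩ := zorn_le_nonempty₀
    {B : Submodule R E | B ≤ A ∧ Disjoint B (B.map f)} (by
    intro c hc hchain y hy
    refine ⟨sSup c, ⟨sSup_le fun D hD => (hc hD).1, disjoint_def.mpr ?_⟩,
      fun D hD => le_sSup hD⟩
    rintro _ hx ⟨z, hz, rfl⟩
    obtain ⟨D₁, hD₁, hx⟩ := (mem_sSup_of_directed ⟨y, hy⟩ hchain.directedOn).mp hx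
    obtain ⟨D₂, hD₂, hz⟩ := (mem_sSup_of_directed ⟨y, hy⟩ hchain.directedOn).mp hz
    obtain ⟨D, hD, h₁, h₂⟩ := hchain.directedOn D₁ hD₁ D₂ hD₂
    exact disjoint_def.mp (hc hD).2 _ (h₁ hx) (mem_map_of_mem (h₂ hz))) ⊥
    ⟨bot_le, disjoint_bot_left⟩
  obtain ⟨hA₀, hA₀f⟩ := hmax.prop
  have hA₀inj := hf.mono_left hA₀
  have hfinj : ∀ x ∈ A, ∀ y ∈ A, f x = f y → x = y := fun x hx y hy hxy =>
    sub_eq_zero.mp (disjoint_def.mp hf _ (sub_mem hx hy) (by simp [hxy]))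
  set W := A₀ ⊔ A₀.map f
  obtain ⟨φ, hφ, hφ₀⟩ := hE.exists_leftInverse_on hA₀inj hA₀f.symm
  obtain ⟨A₁, -, hA₁, hd₁, hess₁⟩ :=
    exists_relative_complement (X := A₀) (bot_le : ⊥ ≤ A) disjoint_bot_right
  obtain ⟨A₂, -, hA₂, hd₂, hess₂⟩ :=
    exists_relative_complement (X := A₁ ⊓ W) (bot_le : ⊥ ≤ A₁) disjoint_bot_right
  obtain ⟨A₃, -, hA₃, hd₃, hess₃⟩ :=
    exists_relative_complement (X := A₂ ⊓ W.comap f) (bot_le : ⊥ ≤ A₂) disjoint_bot_right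
  refine exists_mem_eqOn_of_sup_copy hG hE hA₀inj hA₀f hd₁ hA₀ hA₁ hess₁ ?_
  have hφW : ∀ w ∈ W, φ w ∈ A₀ ∧ w - f (φ w) ∈ A₀ := by
    intro w hw
    obtain ⟨a, ha, _, ⟨b, hb, rfl⟩, rfl⟩ := mem_sup.mp hw
    have : φ (a + f b) = b := by simp [hφ₀ a ha, hφ b hb]
    rw [this]
    exact ⟨hb, by simpa using ha⟩
  refine exists_mem_eqOn_of_sup_copy hG hE (X := A₁ ⊓ W) (h := φ) ?_ ?_ hd₂ inf_le_left hA₂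
    hess₂ ?_
  · refine disjoint_def.mpr fun x hx hx0 => disjoint_def.mp hd₁ x ?_ hx.1
    simpa [LinearMap.mem_ker.mp hx0] using (hφW x hx.2).2
  · refine (hd₁.symm.mono inf_le_left ?_)
    rintro _ ⟨x, hx, rfl⟩
    exact (hφW x hx.2).1
  have hA₂A : A₂ ≤ A := hA₂.trans hA₁
  have hA₂A₀ : Disjoint A₂ A₀ := hd₁.symm.mono_left hA₂
  refine exists_mem_eqOn_of_sup_copy hG hE (X := A₂ ⊓ W.comap f) (h := (1 - f * φ) * f)
    ?_ ?_ hd₃ inf_le_left hA₃ hess₃ ?_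
  · refine disjoint_def.mpr fun x hx hx0 => disjoint_def.mp hA₂A₀ x hx.1 ?_
    have hx0' : f x = f (φ (f x)) := by simpa [sub_eq_zero] using hx0
    have hmem := (hφW _ hx.2).1
    rw [hfinj x (hA₂A hx.1) _ (hA₀ hmem) hx0']
    exact hmem
  · refine hA₂A₀.mono inf_le_left ?_
    rintro _ ⟨x, hx, rfl⟩
    exact (hφW _ hx.2).2
  have hA₃W : Disjoint A₃ W := disjoint_def.mpr fun x hx hxW =>
    disjoint_def.mp hd₂ x ⟨hA₂ (hA₃ hx), hxW⟩ (hA₃ hx)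
  have hfA₃W : ∀ x ∈ A₃, f x ∈ W → x = 0 := fun x hx hxW =>
    disjoint_def.mp hd₃ x ⟨hA₃ hx, hxW⟩ hx
  obtain ⟨p, hp, hpW⟩ := hE.exists_eqOn_and_eq_zero hA₃W 1
  set D := A₃ ⊓ (A₃ ⊔ W).comap f
  have hpf : ∀ x ∈ D, p (f x) ∈ A₃ ∧ f x - p (f x) ∈ W := by
    rintro x ⟨-, hx⟩
    obtain ⟨a, ha, w, hw, haw⟩ := mem_sup.mp hx
    have : p (f x) = a := by simp [← haw, hp a ha, hpW w hw]
    rw [this, ← haw]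
    exact ⟨ha, by simpa using hw⟩
  have hkey : ∀ X ≤ A₃, X ≠ ⊥ → ∃ x ∈ X, x ∈ D ∧ x ≠ 0 ∧ p (f x) ∈ X := by
    intro X hX hX0
    by_contra! hcon
    refine hX0 (disjoint_self.mp ?_)
    suffices Disjoint (A₀ ⊔ X) ((A₀ ⊔ X).map f) by
      have hle := hmax.le_of_ge ⟨sup_le hA₀ (hX.trans (hA₃.trans hA₂A)), this⟩ le_sup_left
      exact (hA₂A₀.mono_left (hX.trans hA₃)).mono_right (le_sup_right.trans hle)
    refine disjoint_def.mpr ?_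
    rintro _ hfz ⟨z, hz, rfl⟩
    obtain ⟨a, ha, x, hx, hax⟩ := mem_sup.mp hfz
    obtain ⟨b, hb, y, hy, rfl⟩ := mem_sup.mp hz
    have hab : a - f b ∈ W :=
      sub_mem (mem_sup_left ha) (mem_sup_right (mem_map_of_mem hb))
    have hfy : f y = x + (a - f b) := by
      rw [map_add] at hax
      rw [← add_sub_assoc, add_comm x, hax, add_sub_cancel_left]
    have hpx : p (f y) = x := by simp [hfy, hp x (hX hx), hpW _ hab]
    have hyD : y ∈ D := ⟨hX hy, show f y ∈ A₃ ⊔ W from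
      hfy ▸ add_mem (mem_sup_left (hX hx)) (mem_sup_right hab)⟩
    have hy0 : y = 0 := by
      by_contra hne
      exact hcon y hy hyD hne (hpx ▸ hx)
    subst hy0
    rw [add_zero] at hax ⊢
    have hx0 : x = 0 := by simpa using hpx.symm
    rw [hx0, add_zero] at hax
    exact disjoint_def.mp hA₀f _ (hax ▸ ha) (mem_map_of_mem hb)
  have hDess : EssentialIn D A₃ := by
    intro Z hZ hZd
    by_contra hne
    obtain ⟨x, hxZ, hxD, hx0, -⟩ := hkey Z hZ hne
    exact hx0 (disjoint_def.mp hZd x hxD hxZ)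
  have hpfinj : ∀ x ∈ D, p (f x) = 0 → x = 0 := fun x hx hx0 =>
    hfA₃W x hx.1 (by simpa [hx0] using (hpf x hx).2)
  obtain ⟨u, huG, hu⟩ := exists_mem_eqOn_of_not_disjoint_map hG hE (D := D) (g := p * f)
    (disjoint_def.mpr fun x hx hx0 => hpfinj x hx hx0) (by
      intro X hX hXd
      by_contra hne
      obtain ⟨x, hxX, hxD, hx0, hx⟩ := hkey X (hX.trans inf_le_left) hne
      exact hx0 (hpfinj x hxD (disjoint_def.mp hXd _ hx ⟨x, hxX, rfl⟩)))
  obtain ⟨v, hvG, hv, -⟩ := exists_mem_eqOn_of_map_le hG hE (X := D) (C := W)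
    (g := (1 - p) * f) (hA₃W.mono_left inf_le_left) (by
      rintro _ ⟨x, hx, rfl⟩
      exact (hpf x hx).2)
  obtain ⟨χ, hχG, hχ, -⟩ := exists_mem_eqOn_of_essentialIn hG hE (C := ⊥) disjoint_bot_right
    inf_le_left hDess (g := f) (add_mem huG hvG) (fun x hx => by simp [hu x hx, hv x hx])
    (by simp)
  exact ⟨χ, hχG, hχ⟩

end UnitStable

theorem exists_extension_end (hE : Module.Injective R E) {M : Submodule R E}
    (a : Module.End R M) : ∃ α : Module.End R E, ∀ x : M, α x = a x := by
  obtain ⟨α, hα, -⟩ :=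
    hE.exists_eq_and_eq_zero (C := ⊥) (disjoint_bot_right (a := M)) (M.subtype ∘ₗ a)
  exact ⟨α, hα⟩

end Module.Injective

/-- For an automorphism-invariant module M, End(M)/J(End(M)) is von Neumann regular. -/
theorem stmt3 {R E : Type*} [Ring R] [AddCommGroup E] [Module R E]
    (hE : Module.Injective R E) (M : Submodule R E)
    (hess : IsEssential M)
    (hinv : ∀ φ : E ≃ₗ[R] E, ∀ x ∈ M, φ x ∈ M) :
    ∀ a : Module.End R ↥M, ∃ b : Module.End R ↥M,
      a * b * a - a ∈ Ideal.jacobson (⊥ : Ideal (Module.End R ↥M)) := by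
  intro a
  let G : Subring (Module.End R E) :=
    { carrier := {ψ | ∀ x ∈ M, ψ x ∈ M}
      mul_mem' := fun hφ hψ x hx => hφ _ (hψ x hx)
      one_mem' := fun x hx => hx
      add_mem' := fun hφ hψ x hx => add_mem (hφ x hx) (hψ x hx)
      zero_mem' := fun x _ => zero_mem M
      neg_mem' := fun hψ x hx => neg_mem (hψ x hx) }
  have hG : ∀ u : Module.End R E, Function.Bijective u → u ∈ G :=
    fun u hu x hx => hinv (LinearEquiv.ofBijective u hu) x hx
  have hMess : Submodule.EssentialIn M ⊤ := fun Z _ hZ =>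
    not_not.mp fun hne => hess Z hne hZ.eq_bot
  obtain ⟨α, hα⟩ := hE.exists_extension_end a
  set K := M ⊓ LinearMap.ker α
  obtain ⟨L, -, hLM, hKL, hKLess⟩ :=
    Submodule.exists_relative_complement (X := K) (bot_le : ⊥ ≤ M) disjoint_bot_right
  have hLα : Disjoint L (LinearMap.ker α) := Submodule.disjoint_def.mpr fun x hx hx0 =>
    Submodule.disjoint_def.mp hKL x ⟨hLM hx, hx0⟩ hx
  obtain ⟨f, hf, -⟩ := hE.exists_leftInverse_on (C := ⊥) hLα disjoint_bot_right
  obtain ⟨β, hβG, hβ⟩ := Module.Injective.exists_mem_eqOn_of_disjoint_ker hG hE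
    (A := L.map α) (f := f) (Submodule.disjoint_def.mpr (by
      rintro _ ⟨x, hx, rfl⟩ hx0
      rw [LinearMap.mem_ker, hf x hx] at hx0
      rw [hx0, map_zero]))
  refine ⟨β.restrict hβG, ?_⟩
  set b := β.restrict hβG with hb
  have hvan : ∀ x : M, (x : E) ∈ K ⊔ L → (a * b * a - a) x = 0 := by
    intro x hx
    obtain ⟨k, hk, l, hl, hkl⟩ := Submodule.mem_sup.mp hx
    have hαx : α x = α l := by simp [← hkl, LinearMap.mem_ker.mp hk.2]
    apply Subtype.ext
    have hβl : β (α l) = l := by rw [hβ _ (Submodule.mem_map_of_mem hl), hf l hl]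
    simp [hb, ← hα, hαx, hβl]
  have hNess : Submodule.EssentialIn (K ⊔ L) ⊤ := by
    intro Z _ hZ
    refine hMess Z le_top (disjoint_iff.mpr (hKLess _ inf_le_left ?_))
    exact hZ.mono_right inf_le_right
  rw [Ideal.mem_jacobson_iff]
  intro y
  obtain ⟨η, hη⟩ := hE.exists_extension_end (y * (a * b * a - a))
  have hbij : Function.Bijective (1 + η : Module.End R E) := by
    refine hE.bijective_one_add (hNess.mono fun x hx => ?_)
    have hxM : x ∈ M := sup_le inf_le_left hLM hx
    rw [LinearMap.mem_ker, hη ⟨x, hxM⟩, Module.End.mul_apply, hvan ⟨x, hxM⟩ hx]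
    simp
  let ζ := (LinearEquiv.ofBijective (1 + η) hbij).symm
  refine ⟨(ζ : Module.End R E).restrict (hinv ζ), ?_⟩
  rw [Ideal.mem_bot, sub_eq_zero]
  ext x
  have h1 : ζ ((1 + η) x) = x := (LinearEquiv.ofBijective (1 + η) hbij).symm_apply_apply x
  have h2 : ζ (η x) + ζ x = x := by
    rw [← map_add, add_comm]
    exact h1
  rw [hη x] at h2
  simpa [mul_assoc] using h2
end

section
/- Let M be a directly-finite automorphism-invariant module with endomorphism ring R. Then R/J(R) is a unit-regular ring. -/
section

variable {R E : Type*} [Ring R] [AddCommGroup E] [Module R E]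

theorem IsEssential.eq_bot {N K : Submodule R E} (hN : IsEssential N)
    (h : ∀ x ∈ N, x ∈ K → x = 0) : K = ⊥ := by
  by_contra hK
  exact hN K hK ((Submodule.eq_bot_iff _).2 fun x hx => h x hx.1 hx.2)

theorem IsEssential.of_forall {N : Submodule R E}
    (h : ∀ K : Submodule R E, (∀ x ∈ N, x ∈ K → x = 0) → K = ⊥) : IsEssential N := by
  intro K hK hNK
  exact hK (h K fun x hx hxK => (Submodule.eq_bot_iff _).1 hNK x ⟨hx, hxK⟩)

/-- Every submodule has a maximal submodule disjoint from it. -/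
theorem Submodule.exists_maximal_disjoint_s13 (U : Submodule R E) :
    ∃ C : Submodule R E, Maximal (Disjoint U) C := by
  obtain ⟨C, -, hC⟩ := zorn_le_nonempty₀ {C : Submodule R E | Disjoint U C} (by
    intro c hc hchain C₀ hC₀
    refine ⟨sSup c, ?_, fun z hz => le_sSup hz⟩
    rw [Set.mem_ofPred_eq, Submodule.disjoint_def]
    intro x hx hxc
    obtain ⟨D, hD, hxD⟩ := (Submodule.mem_sSup_of_directed ⟨C₀, hC₀⟩ hchain.directedOn).1 hxc
    exact Submodule.disjoint_def.1 (hc hD) x hx hxD) ⊥ disjoint_bot_right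
  exact ⟨C, hC⟩

theorem Submodule.isEssential_sup_of_maximal {U C : Submodule R E}
    (hC : Maximal (Disjoint U) C) : IsEssential (U ⊔ C) := by
  refine IsEssential.of_forall fun K hK => ?_
  have hd : Disjoint U (C ⊔ K) := by
    rw [Submodule.disjoint_def]
    intro x hx hxCK
    obtain ⟨c, hc, k, hk, rfl⟩ := Submodule.mem_sup.1 hxCK
    have hk0 : k = 0 := hK k (by
      have := sub_mem (Submodule.mem_sup_left (T := C) hx) (Submodule.mem_sup_right (S := U) hc)
      simpa using this) hk
    subst hk0
    rw [add_zero] at hx ⊢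
    exact Submodule.disjoint_def.1 hC.prop c hx hc
  have hKC : K ≤ C := le_sup_right.trans (hC.le_of_ge hd le_sup_left)
  exact (Submodule.eq_bot_iff _).2 fun x hx => hK x (Submodule.mem_sup_right (hKC hx)) hx

namespace Module.Injective

variable (hE : Module.Injective R E)
include hE

/-- An endomorphism of an injective module extending prescribed maps on two disjoint submodules. -/
theorem exists_glue {U V : Submodule R E} (hUV : Disjoint U V) (f g : Module.End R E) :
    ∃ h : Module.End R E, (∀ u ∈ U, h u = f u) ∧ ∀ v ∈ V, h v = g v := by
  obtain ⟨h, hh⟩ := hE.out (LinearMap.coprod U.subtype V.subtype) (by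
    rw [← LinearMap.ker_eq_bot, LinearMap.ker_eq_bot']
    rintro ⟨u, v⟩ huv
    have huv' : (u : E) + v = 0 := by simpa using huv
    have hu : (u : E) = 0 := Submodule.disjoint_def.1 hUV u u.2 (by
      rw [eq_neg_of_add_eq_zero_left huv']; exact neg_mem v.2)
    have hv : (v : E) = 0 := by simpa [hu] using huv'
    exact Prod.ext (Subtype.ext hu) (Subtype.ext hv)) (LinearMap.coprod (f ∘ₗ U.subtype) (g ∘ₗ V.subtype))
  refine ⟨h, fun u hu => ?_, fun v hv => ?_⟩
  · simpa using hh (⟨u, hu⟩, 0)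
  · simpa using hh (0, ⟨v, hv⟩)

theorem exists_inverse_on {U : Submodule R E} {q : Module.End R E}
    (hq : ∀ u ∈ U, q u = 0 → u = 0) : ∃ r : Module.End R E, ∀ u ∈ U, r (q u) = u := by
  obtain ⟨r, hr⟩ := hE.out (q ∘ₗ U.subtype) (by
    rw [← LinearMap.ker_eq_bot, LinearMap.ker_eq_bot']
    exact fun u hu => Subtype.ext (hq u u.2 hu)) U.subtype
  exact ⟨r, fun u hu => hr ⟨u, hu⟩⟩

/-- An endomorphism inducing a bijection between essential submodules is bijective. -/
theorem bijective_of_essential {P : Submodule R E} (hP : IsEssential P) {f : Module.End R E}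
    (hinj : ∀ p ∈ P, f p = 0 → p = 0) (hsurj : ∀ p ∈ P, ∃ q, f q = p) :
    Function.Bijective f := by
  have hker : LinearMap.ker f = ⊥ := hP.eq_bot fun x hx hxf => hinj x hx hxf
  obtain ⟨r, hr⟩ := hE.exists_inverse_on (U := ⊤) (q := f) fun u _ hu =>
    (LinearMap.ker_eq_bot').1 hker u hu
  have hrker : LinearMap.ker r = ⊥ := hP.eq_bot fun x hx hxr => by
    obtain ⟨q, rfl⟩ := hsurj x hx
    have : q = 0 := by rw [← hr q trivial]; exact hxr
    simp [this]
  refine ⟨LinearMap.ker_eq_bot.1 hker, fun e => ⟨r e, ?_⟩⟩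
  exact LinearMap.ker_eq_bot.1 hrker (hr _ trivial)

end Module.Injective

section Invariant

variable (hE : Module.Injective R E) {M : Submodule R E}
  (hinv : ∀ φ : E ≃ₗ[R] E, ∀ x ∈ M, φ x ∈ M)

include hinv in
theorem mem_of_bijective {f : Module.End R E} (hf : Function.Bijective f) :
    ∀ x ∈ M, f x ∈ M :=
  hinv (LinearEquiv.ofBijective f hf)

include hinv in
/-- An automorphism of `E` restricts to an automorphism of `M`. -/
theorem exists_unit_restrict {f : Module.End R E} (hf : Function.Bijective f) :
    ∃ u : (Module.End R M)ˣ, ∀ m : M, ((u : Module.End R M) m : E) = f m := by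
  let e := LinearEquiv.ofBijective f hf
  refine ⟨⟨e.toLinearMap.restrict (hinv e), e.symm.toLinearMap.restrict (hinv e.symm), ?_, ?_⟩,
    fun m => rfl⟩
  · ext m; simp [LinearMap.restrict_apply]
  · ext m; simp [LinearMap.restrict_apply]

include hE hinv in
/-- A map between two of three independent submodules with essential sum, extended by zero,
extends to an endomorphism of `E` preserving `M`. -/
theorem exists_extend_transfer {A D C : Submodule R E} (hAD : Disjoint A D)
    (hC : Disjoint (A ⊔ D) C) (hess : IsEssential ((A ⊔ D) ⊔ C)) {g : Module.End R E}
    (hg : ∀ a ∈ A, g a ∈ D) :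
    ∃ h : Module.End R E, (∀ x ∈ M, h x ∈ M) ∧ (∀ a ∈ A, h a = g a) ∧ (∀ d ∈ D, h d = 0) ∧
      ∀ c ∈ C, h c = 0 := by
  obtain ⟨k, hkA, hkD⟩ := hE.exists_glue hAD g 0
  obtain ⟨h, hhAD, hhC⟩ := hE.exists_glue hC k 0
  have hA : ∀ a ∈ A, h a = g a := fun a ha => by
    rw [hhAD a (Submodule.mem_sup_left ha), hkA a ha]
  have hD : ∀ d ∈ D, h d = 0 := fun d hd => by
    rw [hhAD d (Submodule.mem_sup_right hd), hkD d hd]; rfl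
  have hP : ∀ p ∈ (A ⊔ D) ⊔ C, h (h p) = 0 := by
    intro p hp
    obtain ⟨q, hq, c, hc, rfl⟩ := Submodule.mem_sup.1 hp
    obtain ⟨a, ha, d, hd, rfl⟩ := Submodule.mem_sup.1 hq
    simp [hA a ha, hD d hd, hhC c hc, hD _ (hg a ha)]
  have hbij : Function.Bijective (1 + h : Module.End R E) := by
    refine hE.bijective_of_essential hess (fun p hp h0 => ?_) fun p hp => ⟨p - h p, ?_⟩
    · have h0' : p + h p = 0 := h0
      have h1 : h p = 0 := by simpa [hP p hp] using congrArg h h0'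
      simpa [h1] using h0'
    · simp [hP p hp]
  refine ⟨h, fun x hx => ?_, hA, hD, hhC⟩
  simpa using sub_mem (mem_of_bijective hinv hbij x hx) hx

end Invariant

/-- The elements `b₀ + f b₁ + ⋯ + fⁿ bₙ` with `bᵢ ∈ B`. -/
inductive InOrbitSum (f : Module.End R E) (B : Submodule R E) : E → Prop
  | zero : InOrbitSum f B 0
  | step {b a : E} : b ∈ B → InOrbitSum f B a → InOrbitSum f B (b + f a)

/-- The submodule `∑ fⁿ B`. -/
def orbitSum (f : Module.End R E) (B : Submodule R E) : Submodule R E where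
  carrier := {x | InOrbitSum f B x}
  zero_mem' := .zero
  add_mem' := by
    intro x y hx hy
    induction hx generalizing y with
    | zero => simpa using hy
    | @step b a hb ha ih =>
      cases hy with
      | zero => simpa using InOrbitSum.step hb ha
      | @step b' a' hb' ha' =>
        have := InOrbitSum.step (add_mem hb hb') (ih ha')
        rwa [map_add, add_add_add_comm] at this
  smul_mem' := by
    intro c x hx
    induction hx with
    | zero => simpa using InOrbitSum.zero
    | @step b a hb ha ih =>
      have := InOrbitSum.step (B.smul_mem c hb) ih
      rwa [map_smul, ← smul_add] at this

theorem le_orbitSum (f : Module.End R E) (B : Submodule R E) : B ≤ orbitSum f B := by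
  intro b hb
  have : b + f 0 ∈ orbitSum f B := InOrbitSum.step hb .zero
  simpa using this

theorem map_mem_orbitSum {f : Module.End R E} {B : Submodule R E} {x : E}
    (hx : x ∈ orbitSum f B) : f x ∈ orbitSum f B := by
  have : 0 + f x ∈ orbitSum f B := InOrbitSum.step B.zero_mem hx
  simpa using this

theorem orbitSum_le {f : Module.End R E} {B Z : Submodule R E} (hB : B ≤ Z)
    (hf : ∀ z ∈ Z, f z ∈ Z) : orbitSum f B ≤ Z := by
  intro x hx
  induction hx with
  | zero => exact Z.zero_mem
  | step hb _ ih => exact add_mem (hB hb) (hf _ ih)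

theorem disjoint_orbitSum_mul_self {f : Module.End R E} {N B : Submodule R E}
    (hfN : ∀ n ∈ N, f n ∈ N) (hinj : ∀ n ∈ N, f n = 0 → n = 0) (hBN : B ≤ N)
    (hB : ∀ n ∈ N, f n ∈ B → f n = 0) :
    Disjoint (orbitSum (f * f) B) ((orbitSum (f * f) B).map f) := by
  have hAN : orbitSum (f * f) B ≤ N := orbitSum_le hBN fun z hz => hfN _ (hfN _ hz)
  have key : ∀ n ∈ N, ∀ n' ∈ N, ∀ b ∈ B, b + f (f n') = f n → n = f n' ∧ b = 0 := by
    intro n hn n' hn' b hb h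
    have hsub : f (n - f n') = b := by rw [map_sub, ← h, add_sub_cancel_right]
    have hmem : n - f n' ∈ N := sub_mem hn (hfN _ hn')
    have h0 := hB _ hmem (hsub ▸ hb)
    exact ⟨sub_eq_zero.1 (hinj _ hmem h0), hsub ▸ h0⟩
  rw [Submodule.disjoint_def]
  rintro x hx ⟨y, hy, rfl⟩
  suffices ∀ a, InOrbitSum (f * f) B a → ∀ a', InOrbitSum (f * f) B a' → a = f a' → a = 0 from
    this _ hx y hy rfl
  intro a ha
  induction ha with
  | zero => exact fun _ _ _ => rfl
  | @step b c hb hc ih =>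
    intro a' ha' h
    obtain ⟨h1, rfl⟩ := key a' (hAN ha') c (hAN hc) b hb h
    cases ha' with
    | zero => rw [h, map_zero]
    | @step b' c' hb' hc' =>
      obtain ⟨h2, -⟩ := key c (hAN hc) c' (hAN hc') b' hb' h1
      simp [ih c' hc' h2]

/-- `G` is the graph of an isomorphism between two submodules of `E`. -/
def IsPartialIso (G : Submodule R (E × E)) : Prop :=
  ∀ p ∈ G, p.1 = 0 ↔ p.2 = 0

theorem IsPartialIso.exists_le_maximal {G₀ : Submodule R (E × E)} (h₀ : IsPartialIso G₀) :
    ∃ G, G₀ ≤ G ∧ Maximal IsPartialIso G := by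
  refine zorn_le_nonempty₀ {G | IsPartialIso G} (fun c hc hchain G hG => ?_) G₀ h₀
  refine ⟨sSup c, fun p hp => ?_, fun z hz => le_sSup hz⟩
  obtain ⟨H, hH, hpH⟩ := (Submodule.mem_sSup_of_directed ⟨G, hG⟩ hchain.directedOn).1 hp
  exact hc hH p hpH

theorem IsPartialIso.exists_extend (hE : Module.Injective R E) {G : Submodule R (E × E)}
    (hG : IsPartialIso G) :
    ∃ W V : Module.End R E, ∀ p ∈ G, W p.1 = p.2 ∧ V p.2 = p.1 := by
  obtain ⟨W, hW⟩ := hE.out (LinearMap.fst R E E ∘ₗ G.subtype) (by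
    rw [← LinearMap.ker_eq_bot, LinearMap.ker_eq_bot']
    exact fun p hp => Subtype.ext (Prod.ext hp ((hG p p.2).1 hp)))
    (LinearMap.snd R E E ∘ₗ G.subtype)
  obtain ⟨V, hV⟩ := hE.out (LinearMap.snd R E E ∘ₗ G.subtype) (by
    rw [← LinearMap.ker_eq_bot, LinearMap.ker_eq_bot']
    exact fun p hp => Subtype.ext (Prod.ext ((hG p p.2).2 hp) hp))
    (LinearMap.fst R E E ∘ₗ G.subtype)
  exact ⟨W, V, fun p hp => ⟨hW ⟨p, hp⟩, hV ⟨p, hp⟩⟩⟩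

/-- The domain of a maximal partial isomorphism of an injective module is a direct summand. -/
theorem exists_retraction_of_maximal (hE : Module.Injective R E) {G : Submodule R (E × E)}
    (hG : Maximal IsPartialIso G) :
    ∃ h : Module.End R E, (∀ e, ∃ p ∈ G, p.1 = h e) ∧ ∀ p ∈ G, h p.1 = p.1 := by
  obtain ⟨W, _, hWV⟩ := hG.prop.exists_extend hE
  obtain ⟨C, hC⟩ := (G.map (LinearMap.fst R E E)).exists_maximal_disjoint_s13
  obtain ⟨h, hA, hhC⟩ := hE.exists_glue hC.prop 1 0
  have hfix : ∀ p ∈ G, h p.1 = p.1 := fun p hp => hA _ ⟨p, hp, rfl⟩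
  have hker : LinearMap.ker (W * h) ≤ C := by
    refine hC.le_of_ge ?_ fun c hc => ?_
    · rw [Submodule.disjoint_def]
      rintro _ ⟨p, hp, rfl⟩ h0
      have : W (h p.1) = 0 := h0
      rw [hfix p hp, (hWV p hp).1] at this
      exact (hG.prop p hp).2 this
    · simp [hhC c hc]
  have hH : IsPartialIso (LinearMap.range (h.prod (W * h))) := by
    rintro _ ⟨e, rfl⟩
    refine ⟨fun h0 => ?_, fun h0 => hhC e (hker h0)⟩
    have : h e = 0 := h0
    simp [this]
  have hle := hG.le_of_ge hH fun p hp =>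
    ⟨p.1, Prod.ext (hfix p hp) (by simp [hfix p hp, (hWV p hp).1])⟩
  exact ⟨h, fun e => ⟨_, hle ⟨e, rfl⟩, rfl⟩, hfix⟩

/-- No nonzero submodule of `X` embeds into `ker f`. -/
def IsOrthogonalToKer (f : Module.End R E) (X : Submodule R E) : Prop :=
  ∀ U ≤ X, ∀ g : Module.End R E, (∀ u ∈ U, g u = 0 → u = 0) → (∀ u ∈ U, f (g u) = 0) → U = ⊥

theorem IsOrthogonalToKer.eq_zero {f : Module.End R E} {X : Submodule R E}
    (hX : IsOrthogonalToKer f X) {x : E} (hx : x ∈ X) (h : f x = 0) : x = 0 :=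
  (Submodule.eq_bot_iff _).1 (hX (X ⊓ LinearMap.ker f) inf_le_left 1 (fun _ _ h => h)
    fun _ hu => hu.2) x ⟨hx, h⟩

theorem IsOrthogonalToKer.sup_map (hE : Module.Injective R E) {f h : Module.End R E}
    {X : Submodule R E} (hh : ∀ e, h (h e) = h e) (hf : ∀ e, h (f e) = f e)
    (hB : IsOrthogonalToKer f (LinearMap.ker h)) (hX : IsOrthogonalToKer f X) :
    IsOrthogonalToKer f (LinearMap.ker h ⊔ X.map f) := by
  intro U hU g hg hfg
  have hV : X ⊓ U.comap f = ⊥ := hX _ inf_le_left (g * f)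
    (fun v hv h0 => hX.eq_zero hv.1 (hg _ hv.2 h0)) fun v hv => hfg _ hv.2
  have hq : ∀ u ∈ U, (1 - h) u = 0 → u = 0 := by
    intro u hu h0
    have hu' : h u = u := (sub_eq_zero.1 h0).symm
    obtain ⟨b, hb, _, ⟨x, hx, rfl⟩, rfl⟩ := Submodule.mem_sup.1 (hU hu)
    have hb0 : b = 0 := by
      rw [map_add, hf, LinearMap.mem_ker.1 hb] at hu'
      exact (add_right_cancel hu').symm
    subst hb0
    rw [zero_add] at hu ⊢
    rw [(Submodule.eq_bot_iff _).1 hV x ⟨hx, hu⟩, map_zero]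
  obtain ⟨r, hr⟩ := hE.exists_inverse_on hq
  have hqU : U.map (1 - h) = ⊥ := by
    refine hB _ ?_ (g * r) ?_ ?_
    · rintro _ ⟨u, -, rfl⟩
      simp [hh]
    · rintro _ ⟨u, hu, rfl⟩ h0
      rw [Module.End.mul_apply, hr u hu] at h0
      rw [hg u hu h0, map_zero]
    · rintro _ ⟨u, hu, rfl⟩
      rw [Module.End.mul_apply, hr u hu]
      exact hfg u hu
  exact (Submodule.eq_bot_iff _).2 fun u hu =>
    hq u hu ((Submodule.eq_bot_iff _).1 hqU _ ⟨u, hu, rfl⟩)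

theorem IsPartialIso.isOrthogonalToKer_of_maximal {G : Submodule R (E × E)}
    (hG : Maximal IsPartialIso G) {f h : Module.End R E} (hh : ∀ p ∈ G, h p.1 = p.1)
    (hf : ∀ p ∈ G, f p.2 = p.1) : IsOrthogonalToKer f (LinearMap.ker h) := by
  intro U hU g hg hfg
  have hle := hG.le_of_ge (y := G ⊔ U.map (LinearMap.prod 1 g)) (by
    intro z hz
    obtain ⟨p, hp, _, ⟨u, hu, rfl⟩, rfl⟩ := Submodule.mem_sup.1 hz
    have hhu : h u = 0 := hU hu
    constructor <;> intro h0
    · replace h0 : p.1 + u = 0 := h0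
      have hp1 : p.1 = 0 := by simpa [hh p hp, hhu] using congrArg h h0
      have hu0 : u = 0 := by simpa [hp1] using h0
      simp [hu0, (hG.prop p hp).1 hp1]
    · replace h0 : p.2 + g u = 0 := h0
      have hp1 : p.1 = 0 := by simpa [hf p hp, hfg u hu] using congrArg f h0
      have hu0 : u = 0 := hg u hu (by simpa [(hG.prop p hp).1 hp1] using h0)
      simp [hu0, hp1]) le_sup_left
  refine (Submodule.eq_bot_iff _).2 fun u hu => ?_
  have hmem := hle (Submodule.mem_sup_right (Submodule.mem_map_of_mem hu))
  exact (hh _ hmem).symm.trans (hU hu)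

section DirectlyFinite

variable (hE : Module.Injective R E) {M : Submodule R E} (hess : IsEssential M)
  (hinv : ∀ φ : E ≃ₗ[R] E, ∀ x ∈ M, φ x ∈ M)
  (hdf : ∀ x y : Module.End R M, x * y = 1 → y * x = 1)
include hE hess hinv hdf

/-- If `f` is injective on `N ⊇ B` and the `fⁿ B` are independent in `N`, then `B = 0`. -/
theorem eq_bot_of_shift {f : Module.End R E} {N B : Submodule R E}
    (hfN : ∀ n ∈ N, f n ∈ N) (hinj : ∀ n ∈ N, f n = 0 → n = 0) (hBN : B ≤ N)
    (hB : ∀ n ∈ N, f n ∈ B → f n = 0) : B = ⊥ := by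
  set A := orbitSum (f * f) B with hA
  set D := A.map f with hD
  have hAN : A ≤ N := orbitSum_le hBN fun z hz => hfN _ (hfN _ hz)
  have hAD : Disjoint A D := disjoint_orbitSum_mul_self hfN hinj hBN hB
  have hfA : ∀ a ∈ A, f a ∈ D := fun a ha => Submodule.mem_map_of_mem ha
  have hfD : ∀ d ∈ D, f d ∈ A := by
    rintro _ ⟨a, ha, rfl⟩
    exact map_mem_orbitSum (f := f * f) ha
  obtain ⟨r, hr⟩ := hE.exists_inverse_on hinj
  obtain ⟨x, hxB, hxN⟩ := hE.exists_glue (U := B) (V := N.map f) (by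
    rw [Submodule.disjoint_def]
    rintro _ hb ⟨n, hn, rfl⟩
    exact hB n hn hb) 0 r
  have hxf : ∀ n ∈ N, x (f n) = n := fun n hn => by
    rw [hxN _ (Submodule.mem_map_of_mem hn), hr n hn]
  have hxD : ∀ d ∈ D, x d ∈ A := by
    rintro _ ⟨a, ha, rfl⟩
    rwa [hxf a (hAN ha)]
  have hxA : ∀ a ∈ A, x a ∈ D := by
    intro a ha
    cases ha with
    | zero => rw [map_zero]; exact D.zero_mem
    | @step b c hb hc =>
      have : x (b + (f * f) c) = f c := by
        rw [map_add, hxB b hb, Module.End.mul_apply, hxf _ (hfN _ (hAN hc))]; exact zero_add _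
      rw [this]
      exact hfA c hc
  obtain ⟨C, hC⟩ := (A ⊔ D).exists_maximal_disjoint_s13
  have hP := Submodule.isEssential_sup_of_maximal hC
  have hC' : Disjoint (D ⊔ A) C := by rw [sup_comm]; exact hC.prop
  have hP' : IsEssential ((D ⊔ A) ⊔ C) := by rwa [sup_comm D A]
  obtain ⟨a, haM, haA, haD, haC⟩ := exists_extend_transfer hE hinv hAD hC.prop hP hfA
  obtain ⟨g, hgM, hgA, hgD, hgC⟩ := exists_extend_transfer hE hinv hAD hC.prop hP hxA
  obtain ⟨c, hcM, hcD, hcA, hcC⟩ := exists_extend_transfer hE hinv hAD.symm hC' hP' hxD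
  obtain ⟨d, hdM, hdD, hdA, hdC⟩ := exists_extend_transfer hE hinv hAD.symm hC' hP' hfD
  let Y : Module.End R E := d * a + 1 - c * a
  let X : Module.End R E := c * g + 1 - c * a
  have hYA : ∀ z ∈ A, Y z = f (f z) := fun z hz => by
    simp [Y, haA z hz, hdD _ (hfA z hz), hcD _ (hfA z hz), hxf z (hAN hz)]
  have hXA : ∀ z ∈ A, X z = x (x z) := fun z hz => by
    simp [X, haA z hz, hgA z hz, hcD _ (hfA z hz), hcD _ (hxA z hz), hxf z (hAN hz)]
  have hXY : ∀ p ∈ (A ⊔ D) ⊔ C, (X * Y) p = p := by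
    intro p hp
    obtain ⟨q, hq, z, hz, rfl⟩ := Submodule.mem_sup.1 hp
    obtain ⟨s, hs, t, ht, rfl⟩ := Submodule.mem_sup.1 hq
    have h1 : X (Y s) = s := by
      rw [hYA s hs, hXA _ (hfD _ (hfA s hs)), hxf _ (hfN _ (hAN hs)), hxf _ (hAN hs)]
    have h2 : X (Y t) = t := by simp [X, Y, haD t ht, hgD t ht]
    have h3 : X (Y z) = z := by simp [X, Y, haC z hz, hgC z hz]
    simp only [Module.End.mul_apply, map_add, h1, h2, h3]
  have hbij : Function.Bijective (X * Y) :=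
    hE.bijective_of_essential hP (fun p hp h => by rwa [hXY p hp] at h) fun p hp => ⟨p, hXY p hp⟩
  obtain ⟨u, hu⟩ := exists_unit_restrict hinv hbij
  have hXM : ∀ m ∈ M, X m ∈ M := fun m hm =>
    sub_mem (add_mem (hcM _ (hgM _ hm)) hm) (hcM _ (haM _ hm))
  have hYM : ∀ m ∈ M, Y m ∈ M := fun m hm =>
    sub_mem (add_mem (hdM _ (haM _ hm)) hm) (hcM _ (haM _ hm))
  have hmul : X.restrict hXM * Y.restrict hYM = (u : Module.End R M) := by
    ext m
    exact (hu m).symm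
  have hone := hdf (X.restrict hXM) (Y.restrict hYM * ↑u⁻¹) (by
    rw [← mul_assoc, hmul, Units.mul_inv])
  have hker : LinearMap.ker X = ⊥ := hess.eq_bot fun m hm hXm => by
    have h0 : X.restrict hXM ⟨m, hm⟩ = 0 := Subtype.ext hXm
    have := LinearMap.congr_fun hone ⟨m, hm⟩
    rw [Module.End.mul_apply, h0, map_zero] at this
    exact (congrArg Subtype.val this).symm
  refine (Submodule.eq_bot_iff _).2 fun b hb => (LinearMap.ker_eq_bot').1 hker b ?_
  rw [hXA b (le_orbitSum _ _ hb), hxB b hb]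
  exact map_zero x

theorem surjective_of_injective {f : Module.End R E} (hf : ∀ e, f e = 0 → e = 0) :
    Function.Surjective f := by
  obtain ⟨r, hr⟩ := hE.exists_inverse_on (U := ⊤) (q := f) fun u _ => hf u
  have hker : LinearMap.ker r = ⊥ :=
    eq_bot_of_shift hE hess hinv hdf (f := f) (N := ⊤) (fun _ _ => trivial) (fun n _ => hf n)
      le_top fun n _ hn => by
        have : n = 0 := by rw [← hr n trivial]; exact hn
        rw [this, map_zero]
  exact fun e => ⟨r e, LinearMap.ker_eq_bot.1 hker (hr _ trivial)⟩

/-- A monomorphism from a submodule of `E` to `E` extends to an automorphism of `E`. -/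
theorem exists_bijective_extend {A : Submodule R E} {w : Module.End R E}
    (hw : ∀ a ∈ A, w a = 0 → a = 0) :
    ∃ W : Module.End R E, Function.Bijective W ∧ ∀ a ∈ A, W a = w a := by
  have h₀ : IsPartialIso (A.map (LinearMap.prod 1 w)) := by
    rintro _ ⟨a, ha, rfl⟩
    refine ⟨fun h0 => ?_, fun h0 => hw a ha h0⟩
    have : a = 0 := h0
    simp [this]
  obtain ⟨G, hG₀, hG⟩ := h₀.exists_le_maximal
  obtain ⟨W, V, hWV⟩ := hG.prop.exists_extend hE
  obtain ⟨h, hhG, hh⟩ := exists_retraction_of_maximal hE hG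
  have hidem : ∀ e, h (h e) = h e := fun e => by
    obtain ⟨p, hp, hpe⟩ := hhG e
    rw [← hpe, hh p hp]
  have hB : IsOrthogonalToKer (h * V) (LinearMap.ker h) :=
    IsPartialIso.isOrthogonalToKer_of_maximal hG hh fun p hp => by
      rw [Module.End.mul_apply, (hWV p hp).2, hh p hp]
  have hinj : ∀ n ∈ orbitSum (h * V) (LinearMap.ker h), (h * V) n = 0 → n = 0 := by
    intro n hn
    suffices ∃ X, IsOrthogonalToKer (h * V) X ∧ n ∈ X by
      obtain ⟨X, hX, hnX⟩ := this
      exact hX.eq_zero hnX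
    induction hn with
    | zero => exact ⟨_, hB, zero_mem _⟩
    | step hb _ ih =>
      obtain ⟨X, hX, hxX⟩ := ih
      exact ⟨_, IsOrthogonalToKer.sup_map hE hidem (fun e => hidem (V e)) hB hX,
        Submodule.add_mem_sup hb (Submodule.mem_map_of_mem hxX)⟩
  have hker : LinearMap.ker h = ⊥ :=
    eq_bot_of_shift hE hess hinv hdf (fun _ hn => map_mem_orbitSum hn) hinj (le_orbitSum _ _)
      fun n _ hn => (hidem (V n)).symm.trans hn
  have hWinj : ∀ e, W e = 0 → e = 0 := by
    intro e he
    obtain ⟨p, hp, hpe⟩ := hhG e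
    rw [LinearMap.ker_eq_bot.1 hker (hidem e)] at hpe
    subst hpe
    rw [(hWV p hp).1] at he
    exact (hG.prop p hp).2 he
  refine ⟨W, ⟨LinearMap.ker_eq_bot.1 ((LinearMap.ker_eq_bot').2 hWinj),
    surjective_of_injective hE hess hinv hdf hWinj⟩, fun a ha => ?_⟩
  exact (hWV _ (hG₀ (Submodule.mem_map_of_mem ha))).1

/-- The endomorphism ring of `E` is unit-regular modulo maps with essential kernel. -/
theorem exists_bijective_mul_mul_sub (F : Module.End R E) :
    ∃ W : Module.End R E, Function.Bijective W ∧
      ∃ P : Submodule R E, IsEssential P ∧ ∀ p ∈ P, F (W (F p)) = F p := by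
  obtain ⟨K, hK⟩ := (LinearMap.ker F).exists_maximal_disjoint_s13
  have hFK : ∀ k ∈ K, F k = 0 → k = 0 := fun k hk h0 =>
    Submodule.disjoint_def.1 hK.prop k h0 hk
  obtain ⟨r, hr⟩ := hE.exists_inverse_on hFK
  obtain ⟨W, hW, hWr⟩ := exists_bijective_extend hE hess hinv hdf (A := K.map F) (w := r) (by
    rintro _ ⟨k, hk, rfl⟩ h0
    rw [hr k hk] at h0
    rw [h0, map_zero])
  refine ⟨W, hW, _, Submodule.isEssential_sup_of_maximal hK, fun p hp => ?_⟩
  obtain ⟨z, hz, k, hk, rfl⟩ := Submodule.mem_sup.1 hp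
  rw [map_add, LinearMap.mem_ker.1 hz, zero_add, hWr _ (Submodule.mem_map_of_mem hk), hr k hk]

end DirectlyFinite

/-- Every endomorphism of a submodule of an injective module extends. -/
theorem exists_extend_end (hE : Module.Injective R E) {M : Submodule R E} (x : Module.End R M) :
    ∃ F : Module.End R E, ∀ m : M, F m = x m :=
  hE.out M.subtype M.injective_subtype (M.subtype ∘ₗ x)

theorem mem_jacobson_of_essential (hE : Module.Injective R E) {M : Submodule R E}
    (hinv : ∀ φ : E ≃ₗ[R] E, ∀ x ∈ M, φ x ∈ M) {d : Module.End R M} {D : Module.End R E}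
    (hD : ∀ m : M, D m = d m) {P : Submodule R E} (hP : IsEssential P)
    (hDP : ∀ p ∈ P, D p = 0) : d ∈ Ideal.jacobson (⊥ : Ideal (Module.End R M)) := by
  rw [Ideal.mem_jacobson_iff]
  intro y
  obtain ⟨Y, hY⟩ := exists_extend_end hE y
  have hfix : ∀ p ∈ P, (1 + Y * D : Module.End R E) p = p := fun p hp => by simp [hDP p hp]
  obtain ⟨u, hu⟩ := exists_unit_restrict hinv (hE.bijective_of_essential hP
    (fun p hp h => by rwa [hfix p hp] at h) fun p hp => ⟨p, hfix p hp⟩)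
  have hu' : (u : Module.End R M) = 1 + y * d := by
    ext m
    simp [hu, hD, hY]
  refine ⟨↑u⁻¹, ?_⟩
  have : (↑u⁻¹ : Module.End R M) * y * d + ↑u⁻¹ - 1 = ↑u⁻¹ * (u : Module.End R M) - 1 := by
    rw [hu', mul_add, mul_one, mul_assoc, add_comm]
  rw [this, Units.inv_mul, sub_self]
  exact zero_mem _

end

/-- If M is a directly-finite automorphism-invariant module, then
End(M)/J(End(M)) is unit-regular. -/
theorem stmt13 {R E : Type*} [Ring R] [AddCommGroup E] [Module R E]
    (hE : Module.Injective R E) (M : Submodule R E)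
    (hess : IsEssential M)
    (hinv : ∀ φ : E ≃ₗ[R] E, ∀ x ∈ M, φ x ∈ M)
    (hdf : ∀ x y : Module.End R ↥M, x * y = 1 → y * x = 1) :
    ∀ x : Module.End R ↥M, ∃ u : (Module.End R ↥M)ˣ,
      x * (u : Module.End R ↥M) * x - x ∈
        Ideal.jacobson (⊥ : Ideal (Module.End R ↥M)) := by
  intro x
  obtain ⟨F, hF⟩ := exists_extend_end hE x
  obtain ⟨W, hW, P, hP, hFP⟩ := exists_bijective_mul_mul_sub hE hess hinv hdf F
  obtain ⟨u, hu⟩ := exists_unit_restrict hinv hW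
  refine ⟨u, mem_jacobson_of_essential hE hinv (D := F * W * F - F) (fun m => ?_) hP fun p hp => ?_⟩
  · simp [hF, ← hu]
  · simp [hFP p hp]
end

section
/- For an automorphism-invariant module M, the following are equivalent: (i) M is directly finite; (ii) M satisfies internal cancellation; (iii) M satisfies the cancellation property. -/
namespace AutInvariant

section Submodules

variable {R : Type u} {V : Type w} [Ring R] [AddCommGroup V] [Module R V]

/-- A submodule all of whose elements satisfy `P` is contained in a maximal one. -/
theorem exists_maximal_forall_mem (P : V → Prop) (G₀ : Submodule R V) (h₀ : ∀ p ∈ G₀, P p) :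
    ∃ G : Submodule R V, G₀ ≤ G ∧ (∀ p ∈ G, P p) ∧
      ∀ H : Submodule R V, G ≤ H → (∀ p ∈ H, P p) → H ≤ G := by
  obtain ⟨G, hG₀, hG⟩ := zorn_le_nonempty₀ {G : Submodule R V | ∀ p ∈ G, P p}
    (fun c hc hchain y hy => ⟨sSup c, fun p hp => by
      obtain ⟨s, hs, hps⟩ := (Submodule.mem_sSup_of_directed ⟨y, hy⟩ hchain.directedOn).1 hp
      exact hc hs p hps, fun z hz => le_sSup hz⟩) G₀ h₀
  exact ⟨G, hG₀, hG.1, fun H hGH hH => hG.2 hH hGH⟩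

/-- The partial sums `B + f B + ⋯ + fⁿ⁻¹ B`. -/
def orbitStage (B : Submodule R V) (f : Module.End R V) : ℕ → Submodule R V
  | 0 => ⊥
  | n + 1 => B ⊔ (orbitStage B f n).map f

theorem orbitStage_mono (B : Submodule R V) (f : Module.End R V) : Monotone (orbitStage B f) := by
  refine monotone_nat_of_le_succ fun n => ?_
  induction n with
  | zero => exact bot_le
  | succ n ih => exact sup_le_sup_left (Submodule.map_mono ih) B

/-- The sum of all `fⁿ B`. -/
def orbit (B : Submodule R V) (f : Module.End R V) : Submodule R V :=
  ⨆ n, orbitStage B f n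

theorem mem_orbit {B : Submodule R V} {f : Module.End R V} {x : V} :
    x ∈ orbit B f ↔ ∃ n, x ∈ orbitStage B f n :=
  Submodule.mem_iSup_of_directed _ (orbitStage_mono B f).directed_le

theorem mem_orbitStage_succ {B : Submodule R V} {f : Module.End R V} {n : ℕ} {x : V} :
    x ∈ orbitStage B f (n + 1) ↔ ∃ b ∈ B, ∃ y ∈ orbitStage B f n, b + f y = x := by
  simp [orbitStage, Submodule.mem_sup]

theorem le_orbit (B : Submodule R V) (f : Module.End R V) : B ≤ orbit B f := fun b hb =>
  mem_orbit.2 ⟨1, mem_orbitStage_succ.2 ⟨b, hb, 0, zero_mem _, by simp⟩⟩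

theorem map_mem_orbit {B : Submodule R V} {f : Module.End R V} {x : V} (hx : x ∈ orbit B f) :
    f x ∈ orbit B f := by
  obtain ⟨n, hn⟩ := mem_orbit.1 hx
  exact mem_orbit.2 ⟨n + 1, mem_orbitStage_succ.2 ⟨0, zero_mem _, x, hn, by simp⟩⟩

theorem orbit_le {B X : Submodule R V} {f : Module.End R V} (hB : B ≤ X)
    (hf : ∀ x ∈ X, f x ∈ X) : orbit B f ≤ X := by
  refine iSup_le fun n => ?_
  induction n with
  | zero => exact bot_le
  | succ n ih =>
    refine sup_le hB ?_
    rintro _ ⟨y, hy, rfl⟩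
    exact hf y (ih hy)

/-- If `f` is injective on `X` and `B ⊓ f X = 0`, the sum of the even iterates of `B` is disjoint
from its image under `f`. -/
theorem orbit_sq_disjoint {B X : Submodule R V} {f : Module.End R V} (hBX : B ≤ X)
    (hf : ∀ x ∈ X, f x ∈ X) (hinj : ∀ x ∈ X, f x = 0 → x = 0)
    (hdisj : ∀ x ∈ X, f x ∈ B → f x = 0) :
    ∀ x ∈ orbit B (f * f), f x ∈ orbit B (f * f) → x = 0 := by
  have hle : orbit B (f * f) ≤ X := orbit_le hBX fun x hx => hf _ (hf _ hx)
  have key : ∀ n, ∀ x ∈ orbitStage B (f * f) n, f x ∈ orbitStage B (f * f) n → x = 0 := by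
    intro n
    induction n with
    | zero => intro x hx _; simpa [orbitStage] using hx
    | succ n ih =>
      intro x hx hfx
      obtain ⟨b, hb, y, hy, rfl⟩ := mem_orbitStage_succ.1 hx
      obtain ⟨c, hc, z, hz, h⟩ := mem_orbitStage_succ.1 hfx
      have hyX : y ∈ X := hle (mem_orbit.2 ⟨n, hy⟩)
      have hzX : z ∈ X := hle (mem_orbit.2 ⟨n, hz⟩)
      simp only [Module.End.mul_apply] at h ⊢
      have hc' : f (b + f (f y) - f z) = c := by
        rw [map_sub, ← h]; abel
      have hmem : b + f (f y) - f z ∈ X :=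
        sub_mem (add_mem (hBX hb) (hf _ (hf _ hyX))) (hf _ hzX)
      have h1 : b + f (f y) - f z = 0 := hinj _ hmem (hdisj _ hmem (hc' ▸ hc))
      have hb' : f (z - f y) = b := by
        rw [map_sub, ← sub_eq_zero, ← neg_eq_zero, ← h1]; abel
      have hmem' : z - f y ∈ X := sub_mem hzX (hf _ hyX)
      have h2 : z - f y = 0 := hinj _ hmem' (hdisj _ hmem' (hb' ▸ hb))
      have h3 : y = 0 := ih y hy (by rw [← sub_eq_zero.1 h2]; exact hz)
      have h4 : b = 0 := by rw [← hb', h2, map_zero]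
      simp [h3, h4]
  intro x hx hfx
  obtain ⟨m, hm⟩ := mem_orbit.1 hx
  obtain ⟨n, hn⟩ := mem_orbit.1 hfx
  exact key (max m n) x (orbitStage_mono _ _ (le_max_left m n) hm)
    (orbitStage_mono _ _ (le_max_right m n) hn)

/-- The ring of endomorphisms preserving a submodule. -/
def preservingSubring (M : Submodule R V) : Subring (Module.End R V) where
  carrier := {t | ∀ m ∈ M, t m ∈ M}
  mul_mem' ha hb m hm := ha _ (hb m hm)
  one_mem' _ hm := hm
  add_mem' ha hb m hm := add_mem (ha m hm) (hb m hm)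
  zero_mem' _ _ := zero_mem M
  neg_mem' ha m hm := neg_mem (ha m hm)

end Submodules

section Rings

variable {S : Type*} [Ring S]

theorem isUnit_one_sub_mul_swap {a b : S} (h : IsUnit (1 - b * a)) : IsUnit (1 - a * b) := by
  obtain ⟨u, hu⟩ := h
  have h1 : (1 - b * a) * (↑u⁻¹ : S) = 1 := by rw [← hu, Units.mul_inv]
  have h2 : (↑u⁻¹ : S) * (1 - b * a) = 1 := by rw [← hu, Units.inv_mul]
  refine ⟨⟨1 - a * b, 1 + a * ↑u⁻¹ * b, ?_, ?_⟩, rfl⟩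
  · calc (1 - a * b) * (1 + a * ↑u⁻¹ * b)
        = 1 - a * b + a * ((1 - b * a) * ↑u⁻¹) * b := by noncomm_ring
      _ = 1 := by rw [h1]; noncomm_ring
  · calc (1 + a * ↑u⁻¹ * b) * (1 - a * b)
        = 1 - a * b + a * (↑u⁻¹ * (1 - b * a)) * b := by noncomm_ring
      _ = 1 := by rw [h2]; noncomm_ring

/-- A subring containing all units contains all elements of square zero. -/
theorem mem_of_mul_self_eq_zero {T : Subring S} (hT : ∀ t, IsUnit t → t ∈ T) {n : S}
    (hn : n * n = 0) : n ∈ T := by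
  have h : IsUnit (1 + n) :=
    ⟨⟨1 + n, 1 - n, by
      calc (1 + n) * (1 - n) = 1 - n * n := by noncomm_ring
        _ = 1 := by rw [hn, sub_zero], by
      calc (1 - n) * (1 + n) = 1 - n * n := by noncomm_ring
        _ = 1 := by rw [hn, sub_zero]⟩, rfl⟩
  simpa using sub_mem (hT _ h) (one_mem T)

/-- If the idempotent `e` factors through `1 - e`, then a subring containing all units contains
the whole corner `e S e`. -/
theorem corner_mem {T : Subring S} (hT : ∀ t, IsUnit t → t ∈ T) {e a b : S} (he : e * e = e)
    (h : e * b * (1 - e) * (a * e) = e) (t : S) : e * t * e ∈ T := by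
  have h0 : (1 - e) * e = 0 := by rw [sub_mul, one_mul, he, sub_self]
  have h0' : e * (1 - e) = 0 := by rw [mul_sub, mul_one, he, sub_self]
  have h1 : (1 - e) * a * e ∈ T := mem_of_mul_self_eq_zero hT (by
    calc (1 - e) * a * e * ((1 - e) * a * e) = (1 - e) * a * (e * (1 - e)) * a * e := by
          simp only [mul_assoc]
      _ = 0 := by rw [h0']; simp)
  have h2 : e * t * e * b * (1 - e) ∈ T := mem_of_mul_self_eq_zero hT (by
    calc e * t * e * b * (1 - e) * (e * t * e * b * (1 - e))
        = e * t * e * b * ((1 - e) * e) * t * e * b * (1 - e) := by simp only [mul_assoc]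
      _ = 0 := by rw [h0]; simp)
  have h3 : (1 - e) * (1 - e) = 1 - e := by rw [mul_sub, h0, sub_zero, mul_one]
  have h4 : e * t * e = e * t * e * b * (1 - e) * ((1 - e) * a * e) := by
    calc e * t * e = e * t * (e * b * (1 - e) * (a * e)) := by rw [h]
      _ = e * t * e * b * ((1 - e) * (1 - e)) * a * e := by rw [h3]; simp only [mul_assoc]
      _ = _ := by simp only [mul_assoc]
  rw [h4]
  exact mul_mem h2 h1

end Rings

section Injective

variable {R : Type u} {E : Type v} [Ring R] [AddCommGroup E] [Module R E]

theorem exists_end_of_graph (hE : Module.Injective R E) (G : Submodule R (E × E))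
    (hG : ∀ p ∈ G, p.1 = 0 → p.2 = 0) : ∃ h : Module.End R E, ∀ p ∈ G, h p.1 = p.2 := by
  obtain ⟨h, hh⟩ := hE.out ((LinearMap.fst R E E).comp G.subtype)
    ((injective_iff_map_eq_zero _).2 fun p hp => Subtype.ext (Prod.ext hp (hG p p.2 hp)))
    ((LinearMap.snd R E E).comp G.subtype)
  exact ⟨h, fun p hp => hh ⟨p, hp⟩⟩

theorem exists_leftInverse_on (hE : Module.Injective R E) (F : Submodule R E)
    (f : Module.End R E) (hf : ∀ x ∈ F, f x = 0 → x = 0) :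
    ∃ g : Module.End R E, ∀ x ∈ F, g (f x) = x := by
  obtain ⟨g, hg⟩ := exists_end_of_graph hE (F.map (f.prod LinearMap.id)) (by
    rintro _ ⟨x, hx, rfl⟩ h
    exact hf x hx h)
  exact ⟨g, fun x hx => hg _ ⟨x, hx, rfl⟩⟩

/-- Every submodule `N` of an injective module is essential in a direct summand, the range of an
idempotent `e`. -/
theorem exists_idempotent_essential (hE : Module.Injective R E) (N : Submodule R E) :
    ∃ e : Module.End R E, e * e = e ∧ (∀ n ∈ N, e n = n) ∧
      ∀ K : Submodule R E, (∀ k ∈ K, e k = k) → (∀ k ∈ K, k ∈ N → k = 0) → ∀ k ∈ K, k = 0 := by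
  obtain ⟨B, -, hB, hBmax⟩ := exists_maximal_forall_mem (R := R) (fun x : E => x ∈ N → x = 0) ⊥
    (fun p hp _ => by simpa using hp)
  obtain ⟨A, hNA, hA, hAmax⟩ := exists_maximal_forall_mem (R := R) (fun x : E => x ∈ B → x = 0) N
    (fun p hp hpB => hB p hpB hp)
  obtain ⟨e, he⟩ := exists_end_of_graph hE
    ((A.prod B).map ((LinearMap.fst R E E + LinearMap.snd R E E).prod (LinearMap.fst R E E))) (by
      rintro _ ⟨⟨a, b⟩, ⟨ha, hb⟩, rfl⟩ h
      have h' : a + b = 0 := h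
      exact hA a ha (by rw [eq_neg_of_add_eq_zero_left h']; exact neg_mem hb))
  have he' : ∀ a ∈ A, ∀ b ∈ B, e (a + b) = a := fun a ha b hb => he _ ⟨(a, b), ⟨ha, hb⟩, rfl⟩
  have heA : ∀ a ∈ A, e a = a := fun a ha => by simpa using he' a ha 0 (zero_mem _)
  have heB : ∀ b ∈ B, e b = 0 := fun b hb => by simpa using he' 0 (zero_mem _) b hb
  have hess : ∀ K : Submodule R E, (∀ k ∈ K, ∃ x, e x = k) → (∀ k ∈ K, k ∈ N → k = 0) →
      ∀ k ∈ K, k = 0 := by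
    intro K hK hKN k hk
    have hle := hBmax (K.comap e) (fun b hb => by simp [heB b hb]) (fun x hx hxN => by
      have hxe := heA x (hNA hxN)
      rw [Submodule.mem_comap, hxe] at hx
      exact hKN x hx hxN)
    obtain ⟨x, rfl⟩ := hK k hk
    exact heB x (hle hk)
  have hrange := hAmax (LinearMap.range e) (fun a ha => ⟨a, heA a ha⟩) (fun x hx hxB =>
    hess (LinearMap.range e ⊓ B) (fun k hk => hk.1) (fun k hk hkN => hB k hk.2 hkN) x ⟨hx, hxB⟩)
  exact ⟨e, LinearMap.ext fun x => heA _ (hrange ⟨x, rfl⟩), fun n hn => heA n (hNA hn),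
    fun K hK => hess K fun k hk => ⟨k, hK k hk⟩⟩

/-- No endomorphism of `E` maps a submodule `X` injectively into itself while missing a nonzero
submodule `B` of `X`. -/
def IsShiftFree (R : Type u) (E : Type v) [Ring R] [AddCommGroup E] [Module R E] : Prop :=
  ∀ (B X : Submodule R E) (f : Module.End R E), B ≤ X → (∀ x ∈ X, f x ∈ X) →
    (∀ x ∈ X, f x = 0 → x = 0) → (∀ x ∈ X, f x ∈ B → f x = 0) → ∀ b ∈ B, b = 0

/-- An injective module is shift-free if it has an essential directly finite submodule preserved by
its automorphisms. -/
theorem isShiftFree (hE : Module.Injective R E) {M : Submodule R E}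
    (hess : ∀ K : Submodule R E, (∀ k ∈ K, k ∈ M → k = 0) → ∀ k ∈ K, k = 0)
    (hU : ∀ t : Module.End R E, IsUnit t → t ∈ preservingSubring M)
    (hDF : ∀ s ∈ preservingSubring M, ∀ t ∈ preservingSubring M, t * s = 1 →
      ∀ m ∈ M, s (t m) = m) : IsShiftFree R E := by
  intro B X f hBX hf hinj hdisj
  set Y := orbit B (f * f)
  have hYX : Y ≤ X := orbit_le hBX fun x hx => hf _ (hf _ hx)
  have hYdisj : ∀ x ∈ Y, f x ∈ Y → x = 0 := orbit_sq_disjoint hBX hf hinj hdisj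
  obtain ⟨e, he, heY, heess⟩ := exists_idempotent_essential hE Y
  have hee : ∀ x, e (e x) = e x := fun x => LinearMap.congr_fun he x
  have heff : ∀ y ∈ Y, e (f (f y)) = f (f y) := fun y hy => heY _ (map_mem_orbit hy)
  set F := LinearMap.range e
  have hFe : ∀ x ∈ F, e x = x := by rintro _ ⟨x, rfl⟩; exact hee x
  have hfF : ∀ x ∈ F, f x = 0 → x = 0 := fun x hx hx0 =>
    heess (F ⊓ LinearMap.ker f) (fun k hk => hFe k hk.1)
      (fun k hk hkY => hinj k (hYX hkY) hk.2) x ⟨hx, hx0⟩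
  have hfFY : ∀ x ∈ F, f x ∈ Y → x = 0 := fun x hx hxY =>
    heess (F ⊓ Y.comap f) (fun k hk => hFe k hk.1)
      (fun k hk hkY => hYdisj k hkY hk.2) x ⟨hx, hxY⟩
  have hfFF : ∀ x ∈ F, f x ∈ F → x = 0 := fun x hx hxF => hfF x hx <|
    heess (F ⊓ F.map f) (fun k hk => hFe k hk.1) (by
      rintro _ ⟨-, z, hz, rfl⟩ hzY
      rw [hfFY z hz hzY, map_zero]) (f x) ⟨hxF, x, hx, rfl⟩
  obtain ⟨g, hg⟩ := exists_leftInverse_on hE F ((1 - e) * f) (fun x hx h => by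
    refine hfFF x hx ⟨f x, ?_⟩
    exact (sub_eq_zero.1 h).symm)
  have hcorner := corner_mem (T := preservingSubring M) hU (e := e) (a := f) (b := g) he (by
    ext x
    have := hg (e x) ⟨x, rfl⟩
    simp only [Module.End.mul_apply] at this ⊢
    rw [this, hee])
  obtain ⟨l, hl⟩ := exists_leftInverse_on hE F (e * (f * f) * e) (fun x hx h =>
    heess (F ⊓ LinearMap.ker (e * (f * f) * e)) (fun k hk => hFe k hk.1) (fun k hk hkY => by
      have h0 : e (f (f (e k))) = 0 := hk.2
      rw [heY k hkY, heff k hkY] at h0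
      exact hinj k (hYX hkY) (hinj _ (hf _ (hYX hkY)) h0)) x ⟨hx, h⟩)
  have hcompl := sub_mem (one_mem (preservingSubring M)) (by simpa [he] using hcorner 1)
  have hst : (e * l * e + (1 - e)) * (e * (f * f) * e + (1 - e)) = 1 := by
    ext x
    have := hl (e x) ⟨x, rfl⟩
    simp only [Module.End.mul_apply, hee] at this
    simp [hee, this]
  have hmain := hDF _ (add_mem (hcorner (f * f)) hcompl) _ (add_mem (hcorner l) hcompl) hst
  refine hess B fun b hb hbM => ?_
  have hbY : b ∈ Y := le_orbit B _ hb
  have hb' := hmain b hbM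
  simp only [LinearMap.add_apply, Module.End.mul_apply, LinearMap.sub_apply, Module.End.one_apply,
    heY b hbY, sub_self, add_zero, hee] at hb'
  have hz : e (l b) = 0 := heess (F ⊓ B.comap (e * (f * f) * e)) (fun k hk => hFe k hk.1)
    (fun k hk hkY => by
      have hk2 : e (f (f (e k))) ∈ B := hk.2
      rw [heY k hkY, heff k hkY] at hk2
      have hfk := hf _ (hYX hkY)
      exact hinj k (hYX hkY) (hinj _ hfk (hdisj _ hfk hk2))) _
    ⟨⟨l b, rfl⟩, by
      change e (f (f (e (e (l b))))) ∈ B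
      rw [hee, hb']; exact hb⟩
  rw [← hb', hz]; simp

theorem IsShiftFree.mul_eq_one_symm (h : IsShiftFree R E) {s t : Module.End R E}
    (hts : t * s = 1) : s * t = 1 := by
  have hts' : ∀ x, t (s x) = x := fun x => LinearMap.congr_fun hts x
  have key := h (LinearMap.range (1 - s * t)) ⊤ s le_top (fun _ _ => trivial)
    (fun x _ hx => by rw [← hts' x, hx, map_zero]) (by
      rintro x - ⟨y, hy⟩
      have := congrArg t hy
      simp only [LinearMap.sub_apply, Module.End.one_apply, Module.End.mul_apply, map_sub, hts',
        sub_self] at this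
      rw [← this, map_zero])
  ext x
  exact (sub_eq_zero.1 (key _ ⟨x, rfl⟩)).symm

theorem IsShiftFree.isUnit (h : IsShiftFree R E) {s t : Module.End R E} (hts : t * s = 1) :
    IsUnit s :=
  ⟨⟨s, t, h.mul_eq_one_symm hts, hts⟩, rfl⟩

theorem IsShiftFree.isUnit_of_ker (h : IsShiftFree R E) (hE : Module.Injective R E)
    {s : Module.End R E} (hs : ∀ x, s x = 0 → x = 0) : IsUnit s := by
  obtain ⟨g, hg⟩ := exists_leftInverse_on hE ⊤ s fun x _ => hs x
  exact h.isUnit (LinearMap.ext fun x => hg x trivial)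

/-- In a shift-free injective module, an isomorphism between two submodules, given by its graph,
extends to an automorphism. -/
theorem IsShiftFree.exists_isUnit_extending (h : IsShiftFree R E) (hE : Module.Injective R E)
    (G₀ : Submodule R (E × E)) (hG₀ : ∀ p ∈ G₀, p.1 = 0 ↔ p.2 = 0) :
    ∃ w : Module.End R E, IsUnit w ∧ ∀ p ∈ G₀, w p.1 = p.2 := by
  obtain ⟨G, hG₀G, hG, hGmax⟩ :=
    exists_maximal_forall_mem (R := R) (fun p : E × E => p.1 = 0 ↔ p.2 = 0) G₀ hG₀
  obtain ⟨e, he, heG, heess⟩ := exists_idempotent_essential hE (G.map (LinearMap.fst R E E))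
  have hee : ∀ x, e (e x) = e x := fun x => LinearMap.congr_fun he x
  have heG' : ∀ p ∈ G, e p.1 = p.1 := fun p hp => heG _ ⟨p, hp, rfl⟩
  obtain ⟨f₀, hf₀⟩ := exists_end_of_graph hE
    (G.map ((LinearMap.snd R E E).prod (LinearMap.fst R E E))) (by
      rintro _ ⟨p, hp, rfl⟩ hp0
      exact (hG p hp).2 hp0)
  have hfG : ∀ p ∈ G, e (f₀ p.2) = p.1 := fun p hp => by
    have : f₀ p.2 = p.1 := hf₀ _ ⟨p, hp, rfl⟩
    rw [this, heG' p hp]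
  set f := e * f₀
  have hef : ∀ x, e (f x) = f x := fun x => hee _
  set B := LinearMap.ker e
  -- no nonzero submodule of `B` is isomorphic to a submodule of the kernel of `f`
  have orth : ∀ H : Submodule R (E × E), (∀ p ∈ H, p.1 = 0 ↔ p.2 = 0) →
      (∀ p ∈ H, p.1 ∈ B ∧ f p.2 = 0) → ∀ p ∈ H, p = 0 := by
    intro H hH hHB
    have hle := hGmax (G ⊔ H) le_sup_left (by
      intro p hp
      obtain ⟨g, hg, q, hq, rfl⟩ := Submodule.mem_sup.1 hp
      have hq1 : e q.1 = 0 := (hHB q hq).1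
      constructor
      · intro h0
        have h0' : g.1 + q.1 = 0 := h0
        have hg1 : g.1 = 0 := by
          have := congrArg e h0'
          rwa [map_add, heG' g hg, hq1, add_zero, map_zero] at this
        have hq0 : q.1 = 0 := by rwa [hg1, zero_add] at h0'
        change g.2 + q.2 = 0
        rw [(hG g hg).1 hg1, (hH q hq).1 hq0, add_zero]
      · intro h0
        have h0' : g.2 + q.2 = 0 := h0
        have hg1 : g.1 = 0 := by
          have := congrArg f h0'
          rw [map_add, (hHB q hq).2, add_zero, map_zero] at this
          rw [← hfG g hg]; exact this
        have hq0 : q.2 = 0 := by rwa [(hG g hg).1 hg1, zero_add] at h0'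
        change g.1 + q.1 = 0
        rw [hg1, (hH q hq).2 hq0, add_zero])
    intro p hp
    have h1 : p.1 = 0 := by
      rw [← heG' p (hle (Submodule.mem_sup_right hp))]
      exact (hHB p hp).1
    exact Prod.ext h1 ((hH p hp).1 h1)
  have orthStage : ∀ n, ∀ H : Submodule R (E × E), (∀ p ∈ H, p.1 = 0 ↔ p.2 = 0) →
      (∀ p ∈ H, p.1 ∈ orbitStage B f n ∧ f p.2 = 0) → ∀ p ∈ H, p = 0 := by
    intro n
    induction n with
    | zero =>
      intro H hH hHn p hp
      have h1 : p.1 = 0 := by simpa [orbitStage] using (hHn p hp).1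
      exact Prod.ext h1 ((hH p hp).1 h1)
    | succ n ih =>
      intro H hH hHn
      have hker : ∀ y ∈ orbitStage B f n, f y = 0 → y = 0 := by
        intro y hy hy0
        have := ih ((orbitStage B f n ⊓ LinearMap.ker f).map
          (LinearMap.id.prod LinearMap.id)) (by rintro _ ⟨z, -, rfl⟩; rfl)
          (by rintro _ ⟨z, hz, rfl⟩; exact hz) (y, y) ⟨y, ⟨hy, hy0⟩, rfl⟩
        exact congrArg Prod.fst this
      have himage : ∀ p ∈ H, ∀ y ∈ orbitStage B f n, f y = p.1 → p = 0 := by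
        intro p hp y hy hyp
        have := ih ((orbitStage B f n).comap (LinearMap.fst R E E) ⊓
          H.comap (f.prodMap LinearMap.id)) (by
            rintro q ⟨hq1, hq2⟩
            have := hH _ hq2
            change f q.1 = 0 ↔ q.2 = 0 at this
            rw [← this]
            exact ⟨fun h => by rw [h, map_zero], hker _ hq1⟩)
          (by rintro q ⟨hq1, hq2⟩; exact ⟨hq1, (hHn _ hq2).2⟩) (y, p.2)
          ⟨hy, by change (f y, p.2) ∈ H; rw [hyp]; exact hp⟩
        have h2 : p.2 = 0 := congrArg Prod.snd this
        exact Prod.ext ((hH p hp).2 h2) h2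
      have hproj : ∀ p ∈ H, p.1 - e p.1 = 0 → p = 0 := by
        intro p hp hp0
        obtain ⟨b, hb, y, hy, hby⟩ := mem_orbitStage_succ.1 (hHn p hp).1
        have hb0 : e b = 0 := hb
        refine himage p hp y hy ?_
        rw [← hby, map_add, hb0, hef, zero_add, add_sub_cancel_right] at hp0
        rw [← hby, hp0, zero_add]
      have := orth (H.map ((1 - e).prodMap LinearMap.id)) (by
          rintro _ ⟨p, hp, rfl⟩
          change p.1 - e p.1 = 0 ↔ p.2 = 0
          refine ⟨fun h0 => by rw [hproj p hp h0]; rfl, fun h0 => ?_⟩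
          rw [(hH p hp).2 h0, map_zero, sub_zero]) (by
          rintro _ ⟨p, hp, rfl⟩
          refine ⟨?_, (hHn p hp).2⟩
          change e (p.1 - e p.1) = 0
          rw [map_sub, hee, sub_self])
      intro p hp
      exact hproj p hp (congrArg Prod.fst (this _ ⟨p, hp, rfl⟩))
  have hB0 : ∀ b ∈ B, b = 0 := by
    refine h B (orbit B f) f (le_orbit B f) (fun x => map_mem_orbit) (fun x hx hx0 => ?_)
      (fun x _ hxB => ?_)
    · obtain ⟨n, hn⟩ := mem_orbit.1 hx
      have := orthStage n ((orbitStage B f n ⊓ LinearMap.ker f).map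
        (LinearMap.id.prod LinearMap.id)) (by rintro _ ⟨z, -, rfl⟩; rfl)
        (by rintro _ ⟨z, hz, rfl⟩; exact hz) (x, x) ⟨x, ⟨hn, hx0⟩, rfl⟩
      exact congrArg Prod.fst this
    · rw [← hef]; exact hxB
  have he1 : ∀ x, e x = x := fun x => by
    have := hB0 (x - e x) (by change e (x - e x) = 0; rw [map_sub, hee, sub_self])
    exact (sub_eq_zero.1 this).symm
  obtain ⟨w, hw⟩ := exists_end_of_graph hE G fun p hp => (hG p hp).1
  refine ⟨w, h.isUnit_of_ker hE fun x hx => ?_, fun p hp => hw p (hG₀G hp)⟩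
  refine heess (LinearMap.ker w) (fun k _ => he1 k) ?_ x hx
  rintro k hk ⟨p, hp, rfl⟩
  exact (hG p hp).2 (by rw [← hw p hp]; exact hk)

/-- Endomorphisms of a shift-free injective module are unit-regular modulo those with essential
kernel. -/
theorem IsShiftFree.exists_unit_essential_ker (h : IsShiftFree R E) (hE : Module.Injective R E)
    (a : Module.End R E) : ∃ w : (Module.End R E)ˣ, ∀ N : Submodule R E,
      (∀ k ∈ N, (a - a * ↑w⁻¹ * a) k = 0 → k = 0) → ∀ k ∈ N, k = 0 := by
  obtain ⟨e, he, heK, heess⟩ := exists_idempotent_essential hE (LinearMap.ker a)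
  have hee : ∀ x, e (e x) = e x := fun x => LinearMap.congr_fun he x
  obtain ⟨_, ⟨w, rfl⟩, hw⟩ := h.exists_isUnit_extending hE
    ((LinearMap.ker e).map (LinearMap.id.prod a)) (by
      rintro _ ⟨c, hc, rfl⟩
      change c = 0 ↔ a c = 0
      refine ⟨fun h => by rw [h, map_zero], fun h => ?_⟩
      rw [← heK c h]; exact hc)
  have hwc : ∀ c, e c = 0 → (↑w⁻¹ : Module.End R E) (a c) = c := fun c hc => by
    have h1 : (w : Module.End R E) c = a c := hw _ ⟨c, hc, rfl⟩
    rw [← h1, ← Module.End.mul_apply, Units.inv_mul, Module.End.one_apply]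
  have hd : ∀ k c, a k = 0 → e c = 0 → (a - a * ↑w⁻¹ * a) (k + c) = 0 := fun k c hk hc => by
    simp [hk, hwc c hc]
  refine ⟨w, fun N hN => ?_⟩
  have hsplit : ∀ x, e (x - e x) = 0 := fun x => by rw [map_sub, hee, sub_self]
  have heN : ∀ k ∈ N, e k = 0 := fun k hk =>
    heess (N.map e) (by rintro _ ⟨x, -, rfl⟩; exact hee x) (by
      rintro _ ⟨x, hx, rfl⟩ hxa
      have := hd (e x) (x - e x) hxa (hsplit x)
      rw [add_sub_cancel] at this
      rw [hN x hx this, map_zero]) (e k) ⟨k, hk, rfl⟩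
  intro k hk
  refine hN k hk ?_
  simpa using hd 0 k (map_zero a) (heN k hk)

theorem IsShiftFree.isUnit_one_sub (h : IsShiftFree R E) (hE : Module.Injective R E)
    {d : Module.End R E}
    (hd : ∀ N : Submodule R E, (∀ k ∈ N, d k = 0 → k = 0) → ∀ k ∈ N, k = 0)
    (x : Module.End R E) : IsUnit (1 - d * x) := by
  refine h.isUnit_of_ker hE fun k hk => ?_
  have hK : ∀ y ∈ LinearMap.ker (1 - d * x), d (x y) = y := fun y hy => (sub_eq_zero.1 hy).symm
  have hx : x k = 0 := hd ((LinearMap.ker (1 - d * x)).map x) (by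
    rintro _ ⟨y, hy, rfl⟩ hy0
    rw [← hK y hy, hy0, map_zero]) _ ⟨k, hk, rfl⟩
  rw [← hK k hk, hx, map_zero]

/-- A ring of endomorphisms of a shift-free injective module that contains all automorphisms has
stable range one. -/
theorem IsShiftFree.exists_isUnit_add (h : IsShiftFree R E) (hE : Module.Injective R E)
    {T : Subring (Module.End R E)} (hT : ∀ t, IsUnit t → t ∈ T) {a : Module.End R E} (ha : a ∈ T)
    (x : Module.End R E) : ∃ z ∈ T, IsUnit (a + (1 - a * x) * z) := by
  obtain ⟨w, hw⟩ := h.exists_unit_essential_ker hE a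
  refine ⟨w - a, sub_mem (hT _ w.isUnit) ha, ?_⟩
  have h1 : a + (1 - a * x) * (w - a) = (1 - a * x * (1 - a * ↑w⁻¹)) * w := by
    have : a * ↑w⁻¹ * (w : Module.End R E) = a := by rw [mul_assoc, Units.inv_mul, mul_one]
    calc a + (1 - a * x) * (w - a) = w - a * x * (w - a) := by noncomm_ring
      _ = w - a * x * (w - a * ↑w⁻¹ * w) := by rw [this]
      _ = _ := by noncomm_ring
  rw [h1]
  refine (isUnit_one_sub_mul_swap ?_).mul w.isUnit
  have h2 : (1 - a * ↑w⁻¹) * (a * x) = (a - a * ↑w⁻¹ * a) * x := by noncomm_ring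
  rw [h2]
  exact h.isUnit_one_sub hE hw x

end Injective

section Cancellation

variable {R : Type u} [Ring R]

/-- Modules whose endomorphism rings have stable range one can be cancelled. -/
theorem nonempty_equiv_of_prod {M A B : Type*} [AddCommGroup M] [AddCommGroup A] [AddCommGroup B]
    [Module R M] [Module R A] [Module R B]
    (hM : ∀ a x : Module.End R M, ∃ z, IsUnit (a + (1 - a * x) * z))
    (φ : (M × A) ≃ₗ[R] (M × B)) : Nonempty (A ≃ₗ[R] B) := by
  let a : Module.End R M := LinearMap.fst R M B ∘ₗ φ.toLinearMap ∘ₗ LinearMap.inl R M A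
  let p : A →ₗ[R] M := LinearMap.fst R M B ∘ₗ φ.toLinearMap ∘ₗ LinearMap.inr R M A
  let x : Module.End R M := LinearMap.fst R M A ∘ₗ φ.symm.toLinearMap ∘ₗ LinearMap.inl R M B
  let q : M →ₗ[R] A := LinearMap.snd R M A ∘ₗ φ.symm.toLinearMap ∘ₗ LinearMap.inl R M B
  have hφ : ∀ m α, (φ (m, α)).1 = a m + p α := fun m α => by
    have : ((m, α) : M × A) = (m, 0) + (0, α) := by simp
    rw [this, map_add]; rfl
  have hpq : ∀ m, (1 - a * x) m = p (q m) := fun m => by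
    have h1 : a (x m) + p (q m) = m := by
      rw [← hφ]
      change (φ (φ.symm (m, 0))).1 = m
      rw [φ.apply_symm_apply]
    rw [LinearMap.sub_apply, sub_eq_iff_eq_add', Module.End.mul_apply, h1, Module.End.one_apply]
  obtain ⟨z, u, hu⟩ := hM a x
  have hu' : ∀ m, (u : Module.End R M) m = a m + p (q (z m)) := fun m => by
    rw [hu, LinearMap.add_apply, Module.End.mul_apply, hpq]
  have hinv : ∀ m, (↑u⁻¹ : Module.End R M) ((u : Module.End R M) m) = m := fun m => by
    rw [← Module.End.mul_apply, Units.inv_mul, Module.End.one_apply]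
  have hinv' : ∀ m, (u : Module.End R M) ((↑u⁻¹ : Module.End R M) m) = m := fun m => by
    rw [← Module.End.mul_apply, Units.mul_inv, Module.End.one_apply]
  let s : A →ₗ[R] M := -((↑u⁻¹ : Module.End R M) ∘ₗ p)
  let k : A →ₗ[R] M × A := s.prod (LinearMap.id + q ∘ₗ z ∘ₗ s)
  have hk : ∀ α, (φ (k α)).1 = 0 := fun α => by
    change (φ (s α, α + q (z (s α)))).1 = 0
    rw [hφ, map_add, add_left_comm, ← hu']
    change p α + (u : Module.End R M) (-(↑u⁻¹ : Module.End R M) (p α)) = 0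
    rw [map_neg, hinv', add_neg_cancel]
  refine ⟨LinearEquiv.ofBijective (LinearMap.snd R M B ∘ₗ φ.toLinearMap ∘ₗ k) ⟨?_, fun β => ?_⟩⟩
  · refine (injective_iff_map_eq_zero _).2 fun α hα => ?_
    have h0 : φ (k α) = 0 := Prod.ext (hk α) hα
    have h1 : k α = 0 := φ.map_eq_zero_iff.1 h0
    have hs : s α = 0 := congrArg Prod.fst h1
    have h2 : α + q (z (s α)) = 0 := congrArg Prod.snd h1
    simpa [hs] using h2
  · obtain ⟨⟨m, α'⟩, hm⟩ := φ.surjective (0, β)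
    have h1 : a m + p α' = 0 := by rw [← hφ, hm]
    have hs : s (α' - q (z m)) = m := by
      change -(↑u⁻¹ : Module.End R M) (p (α' - q (z m))) = m
      have h2 : -p (α' - q (z m)) = (u : Module.End R M) m := by
        rw [hu', map_sub, neg_sub, sub_eq_add_neg, ← eq_neg_of_add_eq_zero_left h1, add_comm]
      rw [← map_neg, h2, hinv]
    have hkm : k (α' - q (z m)) = (m, α') := by
      change (s _, α' - q (z m) + q (z (s _))) = (m, α')
      rw [hs, sub_add_cancel]
    exact ⟨α' - q (z m), by
      change (φ (k _)).2 = β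
      rw [hkm, hm]⟩

theorem nonempty_equiv_of_isCompl {M : Type v} [AddCommGroup M] [Module R M]
    (h : ∀ (A : Type v) (B : Type v) [AddCommGroup A] [Module R A] [AddCommGroup B] [Module R B],
      Nonempty ((M × A) ≃ₗ[R] (M × B)) → Nonempty (A ≃ₗ[R] B))
    {A₁ B₁ A₂ B₂ : Submodule R M} (h₁ : IsCompl A₁ B₁) (h₂ : IsCompl A₂ B₂) (e : A₁ ≃ₗ[R] A₂) :
    Nonempty (B₁ ≃ₗ[R] B₂) := by
  let e₁ : (M × B₂) ≃ₗ[R] ((A₁ × B₁) × B₂) :=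
    (Submodule.prodEquivOfIsCompl A₁ B₁ h₁).symm.prodCongr (LinearEquiv.refl R B₂)
  let e₂ : ((A₁ × B₁) × B₂) ≃ₗ[R] (A₂ × (B₁ × B₂)) :=
    (LinearEquiv.prodAssoc R A₁ B₁ B₂).trans (e.prodCongr (LinearEquiv.refl R _))
  let e₃ : (A₂ × (B₁ × B₂)) ≃ₗ[R] ((A₂ × B₂) × B₁) :=
    ((LinearEquiv.refl R A₂).prodCongr (LinearEquiv.prodComm R B₁ B₂)).trans
      (LinearEquiv.prodAssoc R A₂ B₂ B₁).symm
  let e₄ : ((A₂ × B₂) × B₁) ≃ₗ[R] (M × B₁) :=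
    (Submodule.prodEquivOfIsCompl A₂ B₂ h₂).prodCongr (LinearEquiv.refl R B₁)
  exact h B₁ B₂ ⟨(e₁.trans (e₂.trans (e₃.trans e₄))).symm⟩

theorem mul_eq_one_symm_of_internal_cancellation {M : Type v} [AddCommGroup M] [Module R M]
    (h : ∀ (A₁ B₁ A₂ B₂ : Submodule R M), IsCompl A₁ B₁ → IsCompl A₂ B₂ →
      Nonempty (A₁ ≃ₗ[R] A₂) → Nonempty (B₁ ≃ₗ[R] B₂)) {x y : Module.End R M} (hxy : x * y = 1) :
    y * x = 1 := by
  have hxy' : ∀ m, x (y m) = m := fun m => LinearMap.congr_fun hxy m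
  have hc : IsCompl (LinearMap.range y) (LinearMap.ker x) := by
    refine IsCompl.of_eq (eq_bot_iff.2 ?_) (eq_top_iff.2 fun m _ => ?_)
    · rintro _ ⟨⟨m, rfl⟩, hm⟩
      have hm' : x (y m) = 0 := hm
      rw [hxy'] at hm'
      simp [hm']
    · refine Submodule.mem_sup.2 ⟨y (x m), ⟨_, rfl⟩, m - y (x m), ?_, add_sub_cancel _ _⟩
      rw [LinearMap.mem_ker, map_sub, hxy', sub_self]
  obtain ⟨e⟩ := h _ _ ⊤ ⊥ hc isCompl_top_bot
    ⟨(LinearEquiv.ofInjective y (Function.LeftInverse.injective hxy')).symm.trans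
      Submodule.topEquiv.symm⟩
  ext m
  have hm : x (y (x m) - m) = 0 := by rw [map_sub, hxy', sub_self]
  have : (⟨y (x m) - m, hm⟩ : LinearMap.ker x) = 0 := e.injective (Subsingleton.elim _ _)
  exact sub_eq_zero.1 (congrArg Subtype.val this)

/-- Restriction of endomorphisms to a preserved submodule. -/
def restrictHom {E : Type v} [AddCommGroup E] [Module R E] (M : Submodule R E) :
    preservingSubring M →+* Module.End R M where
  toFun t := LinearMap.restrict t.1 t.2
  map_one' := rfl
  map_mul' _ _ := rfl
  map_zero' := rfl
  map_add' _ _ := rfl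

variable {E : Type v} [AddCommGroup E] [Module R E]

theorem mem_preservingSubring_of_isUnit {M : Submodule R E}
    (hinv : ∀ φ : E ≃ₗ[R] E, ∀ x ∈ M, φ x ∈ M) {t : Module.End R E} (ht : IsUnit t) :
    t ∈ preservingSubring M :=
  hinv (LinearEquiv.ofBijective t ((Module.End.isUnit_iff t).1 ht))

theorem restrictHom_surjective (hE : Module.Injective R E) (M : Submodule R E) :
    Function.Surjective (restrictHom M) := by
  intro a
  obtain ⟨t, ht⟩ := hE.out M.subtype M.subtype_injective (M.subtype ∘ₗ a)
  have ht' : ∀ m : M, t m = a m := ht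
  exact ⟨⟨t, fun m hm => by rw [ht' ⟨m, hm⟩]; exact (a ⟨m, hm⟩).2⟩,
    LinearMap.ext fun m => Subtype.ext (ht' m)⟩

/-- The endomorphism ring of a directly finite automorphism-invariant module has stable range
one. -/
theorem exists_isUnit_add_of_directlyFinite (hE : Module.Injective R E) {M : Submodule R E}
    (hess : IsEssential M) (hinv : ∀ φ : E ≃ₗ[R] E, ∀ x ∈ M, φ x ∈ M)
    (hM : ∀ x y : Module.End R M, x * y = 1 → y * x = 1) (a x : Module.End R M) :
    ∃ z, IsUnit (a + (1 - a * x) * z) := by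
  have hU : ∀ t : Module.End R E, IsUnit t → t ∈ preservingSubring M :=
    fun t => mem_preservingSubring_of_isUnit hinv
  have hfree : IsShiftFree R E := isShiftFree (M := M) hE (fun K hK => by
      by_contra! hne
      obtain ⟨k, hk, hk0⟩ := hne
      refine hess K (fun h => hk0 (by simpa [h] using hk)) (eq_bot_iff.2 fun y hy => ?_)
      exact hK y hy.2 hy.1) hU
    (fun s hs t ht hts m hm => by
      have h1 : (⟨t, ht⟩ : preservingSubring M) * ⟨s, hs⟩ = 1 := Subtype.ext hts
      have h2 := hM (restrictHom M ⟨t, ht⟩) (restrictHom M ⟨s, hs⟩) (by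
        rw [← map_mul, h1, map_one])
      exact congrArg Subtype.val (LinearMap.congr_fun h2 ⟨m, hm⟩))
  obtain ⟨a, rfl⟩ := restrictHom_surjective hE M a
  obtain ⟨x, rfl⟩ := restrictHom_surjective hE M x
  obtain ⟨z, hz, u, hu⟩ := hfree.exists_isUnit_add hE hU a.2 x.1
  have hunit : IsUnit (a + (1 - a * x) * ⟨z, hz⟩) :=
    ⟨⟨_, ⟨↑u⁻¹, hU _ u⁻¹.isUnit⟩, Subtype.ext (by
      change (a.1 + (1 - a.1 * x.1) * z) * ↑u⁻¹ = 1
      rw [← hu, Units.mul_inv]), Subtype.ext (by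
      change ↑u⁻¹ * (a.1 + (1 - a.1 * x.1) * z) = 1
      rw [← hu, Units.inv_mul])⟩, rfl⟩
  exact ⟨restrictHom M ⟨z, hz⟩, by simpa using hunit.map (restrictHom M)⟩

end Cancellation

end AutInvariant

/-- For an automorphism-invariant module M, the following are equivalent:
(i) M is directly finite; (ii) M satisfies internal cancellation;
(iii) M satisfies the cancellation property. -/
theorem stmt16 {R : Type u} {E : Type v} [Ring R] [AddCommGroup E] [Module R E]
    (hE : Module.Injective R E) (M : Submodule R E)
    (hess : IsEssential M)
    (hinv : ∀ φ : E ≃ₗ[R] E, ∀ x ∈ M, φ x ∈ M) :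
    ((∀ x y : Module.End R ↥M, x * y = 1 → y * x = 1) ↔
      (∀ (A₁ B₁ A₂ B₂ : Submodule R ↥M), IsCompl A₁ B₁ → IsCompl A₂ B₂ →
        Nonempty (↥A₁ ≃ₗ[R] ↥A₂) → Nonempty (↥B₁ ≃ₗ[R] ↥B₂))) ∧
    ((∀ (A₁ B₁ A₂ B₂ : Submodule R ↥M), IsCompl A₁ B₁ → IsCompl A₂ B₂ →
        Nonempty (↥A₁ ≃ₗ[R] ↥A₂) → Nonempty (↥B₁ ≃ₗ[R] ↥B₂)) ↔
      (∀ (A : Type v) (B : Type v) [AddCommGroup A] [Module R A]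
        [AddCommGroup B] [Module R B],
        Nonempty ((↥M × A) ≃ₗ[R] (↥M × B)) → Nonempty (A ≃ₗ[R] B))) := by
  have h₁₃ := fun hM : ∀ x y : Module.End R M, x * y = 1 → y * x = 1 =>
    AutInvariant.exists_isUnit_add_of_directlyFinite hE hess hinv hM
  refine ⟨⟨fun hM A₁ B₁ A₂ B₂ h₁ h₂ ⟨e⟩ => ?_, fun h x y =>
    AutInvariant.mul_eq_one_symm_of_internal_cancellation h⟩,
    fun h A B _ _ _ _ ⟨φ⟩ => ?_, fun h A₁ B₁ A₂ B₂ h₁ h₂ ⟨e⟩ =>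
    AutInvariant.nonempty_equiv_of_isCompl h h₁ h₂ e⟩
  · exact AutInvariant.nonempty_equiv_of_isCompl (fun A B _ _ _ _ ⟨φ⟩ =>
      AutInvariant.nonempty_equiv_of_prod (h₁₃ hM) φ) h₁ h₂ e
  · exact AutInvariant.nonempty_equiv_of_prod
      (h₁₃ fun x y => AutInvariant.mul_eq_one_symm_of_internal_cancellation h) φ
end
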